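/- The map f : ℙ¹(K) → ℙ²(K) is injective (equivalently, C is a cuspidal curve: every singular point of C has exactly one preimage under f, i.e., is unibranched) if and only if every point (x_0:x_1:x_2) ∈ X_2(K) lies on the conic 4x_0x_2 − x_1² = 0 (equivalently, every binary form G with [G] ∈ X_2(K) is the square of a linear form). Moreover, in that case the number of singular points of C equals the cardinality of X_2(K). -/

import Mathlib

open MvPolynomial

noncomputable section

/-- The coefficient `a_i` of `s^(n-i) t^i` in a binary form `f` of degree `n`. -/
def bcoeff {K : Type*} [Field K] (n : ℕ) (f : MvPolynomial (Fin 2) K) (i : Fin (n + 1)) : K :=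
  MvPolynomial.coeff (Finsupp.single 0 (n - (i : ℕ)) + Finsupp.single 1 (i : ℕ)) f

/-- The binary form of degree `k` with coefficient vector `x`. -/
def formOf {K : Type*} [Field K] (k : ℕ) (x : Fin (k + 1) → K) : MvPolynomial (Fin 2) K :=
  ∑ i : Fin (k + 1),
    MvPolynomial.C (x i) * MvPolynomial.X 0 ^ (k - (i : ℕ)) * MvPolynomial.X 1 ^ (i : ℕ)

/-- The matrix `M_k` associated to the parameterization `f`: the first `n-k+1` rows contain
the variables `x_0, …, x_k` in staircase position, the last three rows are the coefficient
vectors of `f_0, f_1, f_2`. -/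
def Mmat {K : Type*} [Field K] (n k : ℕ) (f : Fin 3 → MvPolynomial (Fin 2) K) :
    Matrix (Fin (n - k + 4)) (Fin (n + 1)) (MvPolynomial (Fin (k + 1)) K) :=
  fun j c =>
    if hj : (j : ℕ) ≤ n - k then
      if h : (j : ℕ) ≤ (c : ℕ) ∧ (c : ℕ) ≤ (j : ℕ) + k then
        MvPolynomial.X ⟨(c : ℕ) - (j : ℕ), by omega⟩
      else 0
    else
      MvPolynomial.C (bcoeff n (f ⟨(j : ℕ) - (n - k + 1), by have := j.isLt; omega⟩) c)

/-- The set of `(n-k+3) × (n-k+3)` minors of the matrix `M_k`; it generates the ideal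
`I_{X_k}`. -/
def minorsSet {K : Type*} [Field K] (n k : ℕ) (f : Fin 3 → MvPolynomial (Fin 2) K) :
    Set (MvPolynomial (Fin (k + 1)) K) :=
  { g | ∃ (r : Fin (n - k + 3) → Fin (n - k + 4)) (c : Fin (n - k + 3) → Fin (n + 1)),
      Function.Injective r ∧ Function.Injective c ∧
      g = ((Mmat n k f).submatrix r c).det }

/-- The projective zero locus `X_k(K) ⊆ ℙ^k(K)` of the ideal of minors of `M_k`. -/
def XkSet {K : Type*} [Field K] (n k : ℕ) (f : Fin 3 → MvPolynomial (Fin 2) K) :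
    Set (Projectivization K (Fin (k + 1) → K)) :=
  { P | ∀ g ∈ minorsSet n k f, MvPolynomial.eval P.rep g = 0 }

/-- Evaluation of the parameterization at a vector `v ∈ K²`. -/
def evalVec {K : Type*} [Field K] (f : Fin 3 → MvPolynomial (Fin 2) K) (v : Fin 2 → K) :
    Fin 3 → K :=
  fun u => MvPolynomial.eval v (f u)

/-- The induced map `f : ℙ¹(K) → ℙ²(K)` (with a junk value where undefined). -/
def projMap {K : Type*} [Field K] (f : Fin 3 → MvPolynomial (Fin 2) K)
    (P : Projectivization K (Fin 2 → K)) : Projectivization K (Fin 3 → K) :=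
  haveI := Classical.propDecidable (evalVec f P.rep ≠ 0)
  if h : evalVec f P.rep ≠ 0 then Projectivization.mk K _ h
  else Projectivization.mk K (fun _ => 1) (fun hc => one_ne_zero (congrFun hc 0))

/-- `f = (f_0, f_1, f_2)` is a proper parameterization of degree `n`: the `f_u` are
homogeneous of degree `n`, have no common zero outside the origin, and the induced map
`ℙ¹(K) → ℙ²(K)` is injective outside some finite set. -/
structure IsProperParam {K : Type*} [Field K] (n : ℕ)
    (f : Fin 3 → MvPolynomial (Fin 2) K) : Prop where
  homog : ∀ u, (f u).IsHomogeneous n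
  no_common_zero : ∀ v : Fin 2 → K, v ≠ 0 → evalVec f v ≠ 0
  gen_injective : ∃ S : Set (Projectivization K (Fin 2 → K)), S.Finite ∧
    Set.InjOn (projMap f) Sᶜ

/-- The homogeneous vanishing ideal of the point `p ∈ ℙ²(K)`. -/
def pointIdeal {K : Type*} [Field K] (p : Fin 3 → K) : Ideal (MvPolynomial (Fin 3) K) :=
  Ideal.span { L | L.IsHomogeneous 1 ∧ MvPolynomial.eval p L = 0 }

/-- The multiplicity of the curve `{F = 0}` at the point `p`:
the largest `m` with `F ∈ I(p)^m`. -/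
def multAt {K : Type*} [Field K] (F : MvPolynomial (Fin 3) K) (p : Fin 3 → K) : ℕ :=
  sSup { m | F ∈ pointIdeal p ^ m }

/-- The cross difference `p_i f_j - p_j f_i`. -/
def crossDiff {K : Type*} [Field K] (f : Fin 3 → MvPolynomial (Fin 2) K) (p : Fin 3 → K)
    (i j : Fin 3) : MvPolynomial (Fin 2) K :=
  MvPolynomial.C (p i) * f j - MvPolynomial.C (p j) * f i

/-- `G` is a greatest common divisor of the three cross differences `p_i f_j - p_j f_i`,
`0 ≤ i < j ≤ 2`. -/
def IsGcdOfCross {K : Type*} [Field K] (f : Fin 3 → MvPolynomial (Fin 2) K) (p : Fin 3 → K)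
    (G : MvPolynomial (Fin 2) K) : Prop :=
  (∀ i j : Fin 3, i < j → G ∣ crossDiff f p i j) ∧
  (∀ D : MvPolynomial (Fin 2) K, (∀ i j : Fin 3, i < j → D ∣ crossDiff f p i j) → D ∣ G)

/-- The linear binary form with root `v = (v 0 : v 1)`. -/
def linFormOf {K : Type*} [Field K] (v : Fin 2 → K) : MvPolynomial (Fin 2) K :=
  MvPolynomial.C (v 1) * MvPolynomial.X 0 - MvPolynomial.C (v 0) * MvPolynomial.X 1

/-- The multiplicity of `v` as a root of the binary form `h`. -/
def ordAt {K : Type*} [Field K] (v : Fin 2 → K) (h : MvPolynomial (Fin 2) K) : ℕ :=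
  sSup { e | linFormOf v ^ e ∣ h }

/-- The point `x ∈ ℙ²` lies on the conic `4 x₀ x₂ - x₁² = 0`. -/
def onConic {K : Type*} [Field K] (x : Fin 3 → K) : Prop :=
  4 * x 0 * x 2 - x 1 ^ 2 = 0

/-- A homogeneous form scales by the power of its degree. -/
lemma eval_smul_of_isHomogeneous {K σ : Type*} [Field K] {F : MvPolynomial σ K} {n : ℕ}
    (hF : F.IsHomogeneous n) (c : K) (v : σ → K) :
    eval (c • v) F = c ^ n * eval v F := by
  rw [eval_eq, eval_eq, Finset.mul_sum]
  refine Finset.sum_congr rfl fun e he => ?_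
  have hdeg : ∑ i ∈ e.support, e i = n := (hF.degree_eq_sum_deg_support he).symm
  simp only [Pi.smul_apply, smul_eq_mul, mul_pow, Finset.prod_mul_distrib,
    Finset.prod_pow_eq_pow_sum, hdeg]
  ring

/-- For all but finitely many `γ`, the pencil member `a - γ b` of a coprime pair has as many
distinct roots as its degree, none of them in a prescribed finite set. -/
lemma exists_generic_fibre {K : Type*} [Field K] [IsAlgClosed K] [CharZero K]
    {a b : Polynomial K} (hab : IsCoprime a b) {T : Set K} (hT : T.Finite) :
    ∃ B : Set K, B.Finite ∧ ∀ γ ∉ B, ∃ S : Finset K,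
      S.card = max a.natDegree b.natDegree ∧
      ∀ τ ∈ S, a.eval τ = γ * b.eval τ ∧ b.eval τ ≠ 0 ∧ τ ∉ T := by
  classical
  rcases Nat.eq_zero_or_pos (max a.natDegree b.natDegree) with hd | hd
  · exact ⟨∅, Set.finite_empty, fun γ _ => ⟨∅, by simp [hd], by simp⟩⟩
  set d := max a.natDegree b.natDegree with hd_def
  have hW : a.wronskian b ≠ 0 := by
    intro h
    obtain ⟨ha, hb⟩ := hab.wronskian_eq_zero_iff.1 h
    have ha' := Polynomial.derivative_eq_zero.1 ha
    have hb' := Polynomial.derivative_eq_zero.1 hb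
    omega
  refine ⟨(fun τ => a.eval τ / b.eval τ) '' (T ∪ (a.wronskian b).roots.toFinset) ∪
    {a.coeff d / b.coeff d}, ((hT.union (Finset.finite_toSet _)).image _).union
      (Set.finite_singleton _), fun γ hγ => ?_⟩
  simp only [Set.union_singleton, Set.mem_insert_iff, Set.mem_image, not_or, not_exists] at hγ
  obtain ⟨hγd, hγT⟩ := hγ
  set e := a - Polynomial.C γ * b with he
  have hcoef : e.coeff d ≠ 0 := by
    simp only [he, Polynomial.coeff_sub, Polynomial.coeff_C_mul]
    intro h
    have h1 : a.coeff d = γ * b.coeff d := sub_eq_zero.1 h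
    by_cases hb : b.coeff d = 0
    · have ha : a.coeff d = 0 := by rw [h1, hb, mul_zero]
      rcases max_choice a.natDegree b.natDegree with hm | hm
      · rw [hd_def, hm] at ha
        have := Polynomial.leadingCoeff_eq_zero.1 ha
        rw [hd_def, hm, this] at hd
        simp at hd
      · rw [hd_def, hm] at hb
        have := Polynomial.leadingCoeff_eq_zero.1 hb
        rw [hd_def, hm, this] at hd
        simp at hd
    · exact hγd (by rw [h1]; field_simp)
  have he0 : e ≠ 0 := by
    intro h
    rw [h] at hcoef
    simp at hcoef
  have hdeg : e.natDegree = d := by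
    refine le_antisymm ?_ (Polynomial.le_natDegree_of_ne_zero hcoef)
    refine (Polynomial.natDegree_sub_le _ _).trans (max_le_max le_rfl ?_)
    exact Polynomial.natDegree_C_mul_le _ _
  have hroot : ∀ τ, e.IsRoot τ → a.eval τ = γ * b.eval τ ∧ b.eval τ ≠ 0 ∧
      τ ∉ T ∪ (a.wronskian b).roots.toFinset := by
    intro τ hτ
    have h1 : a.eval τ = γ * b.eval τ := by
      have : e.eval τ = 0 := hτ
      simpa [he, sub_eq_zero] using this
    have h2 : b.eval τ ≠ 0 := by
      intro h
      obtain ⟨u, v, huv⟩ := hab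
      have := congrArg (Polynomial.eval τ) huv
      simp [h1, h] at this
    exact ⟨h1, h2, fun h => hγT τ ⟨h, by rw [h1]; field_simp⟩⟩
  refine ⟨e.roots.toFinset, ?_, fun τ hτ => ?_⟩
  · rw [Multiset.toFinset_card_of_nodup, IsAlgClosed.card_roots_eq_natDegree, hdeg]
    rw [Multiset.nodup_iff_count_le_one]
    intro τ
    rw [Polynomial.count_roots]
    by_contra hlt
    obtain ⟨hr, hr'⟩ := (Polynomial.one_lt_rootMultiplicity_iff_isRoot he0).1 (not_le.1 hlt)
    obtain ⟨h1, -, h3⟩ := hroot τ hr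
    refine h3 (Or.inr ?_)
    have h4 : (Polynomial.derivative a).eval τ = γ * (Polynomial.derivative b).eval τ := by
      have : (Polynomial.derivative e).eval τ = 0 := hr'
      simpa [he, sub_eq_zero] using this
    simp only [Finset.mem_coe, Multiset.mem_toFinset, Polynomial.mem_roots hW]
    simp only [Polynomial.IsRoot, Polynomial.wronskian, Polynomial.eval_sub, Polynomial.eval_mul,
      h1, h4]
    ring
  · rw [Multiset.mem_toFinset, Polynomial.mem_roots he0] at hτ
    obtain ⟨h1, h2, h3⟩ := hroot τ hτ
    exact ⟨h1, h2, fun h => h3 (Or.inl h)⟩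

/-- A generically injective plane curve parameterization in an affine chart of the source,
together with an irreducible form of degree `n` vanishing on it. -/
structure IsAffineParam {K : Type*} [Field K] (n : ℕ) (p : Fin 3 → Polynomial K)
    (F : MvPolynomial (Fin 3) K) : Prop where
  natDegree_le : ∀ u, (p u).natDegree ≤ n
  generically_injective : ∃ T : Set K, T.Finite ∧ ∀ τ σ, τ ∉ T → σ ∉ T → ∀ c : K,
    (∀ u, (p u).eval τ = c * (p u).eval σ) → τ = σ
  irreducible : Irreducible F
  isHomogeneous : F.IsHomogeneous n
  eval_eq_zero : ∀ τ, eval (fun u => (p u).eval τ) F = 0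

lemma eval_cons_eq {K : Type*} [Field K] (F : MvPolynomial (Fin 3) K) (z : K) (w : Fin 2 → K) :
    eval (Fin.cons z w : Fin 3 → K) F = ((finSuccEquiv K 2 F).map (eval w)).eval z :=
  eval_eq_eval_mv_eval' w z F

/-- A nonzero binary form has only finitely many zeros `(γ, 1)`. -/
lemma finite_zeros_of_isHomogeneous {K : Type*} [Field K] [Infinite K]
    {c : MvPolynomial (Fin 2) K} {m : ℕ} (hc : c.IsHomogeneous m) (hc0 : c ≠ 0) :
    {γ : K | eval ![γ, 1] c = 0}.Finite := by
  classical
  set q : Polynomial K := aeval ![Polynomial.X, 1] c with hq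
  have hqe : ∀ γ, q.eval γ = eval ![γ, 1] c := by
    intro γ
    have : (Polynomial.aeval γ).comp (aeval ![Polynomial.X, (1 : Polynomial K)])
        = aeval (R := K) ![γ, 1] := by
      ext i
      fin_cases i <;> simp
    have := DFunLike.congr_fun this c
    simpa [hq, Polynomial.coe_aeval_eq_eval, aeval_eq_eval] using this
  have hq0 : q ≠ 0 := by
    intro h0
    have hz : ∀ γ, eval ![γ, 1] c = 0 := fun γ => by rw [← hqe, h0, Polynomial.eval_zero]
    have : c * X 1 = 0 := by
      refine MvPolynomial.funext fun v => ?_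
      by_cases hv : v 1 = 0
      · simp [hv]
      · have hv' : v = v 1 • ![v 0 / v 1, 1] := by
          ext i
          fin_cases i <;> simp [hv, mul_div_cancel₀]
        rw [map_mul, hv', eval_smul_of_isHomogeneous hc, hz]
        simp
    rcases mul_eq_zero.1 this with h | h
    · exact hc0 h
    · exact X_ne_zero _ h
  refine (Finset.finite_toSet q.roots.toFinset).subset fun γ hγ => ?_
  simp only [Finset.mem_coe, Multiset.mem_toFinset, Polynomial.mem_roots hq0]
  rw [Polynomial.IsRoot, hqe]
  exact hγ

namespace IsAffineParam

variable {K : Type*} [Field K] {n : ℕ} {p : Fin 3 → Polynomial K}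
  {F : MvPolynomial (Fin 3) K}

/-- The last two coordinates of a generically injective parameterization do not both vanish. -/
lemma not_both_zero [Infinite K] (h : IsAffineParam n p F) : ¬ (p 1 = 0 ∧ p 2 = 0) := by
  classical
  rintro ⟨h1, h2⟩
  obtain ⟨T, hT, hinj⟩ := h.generically_injective
  by_cases h0 : p 0 = 0
  · obtain ⟨τ, hτ, σ, hσ, hne⟩ := hT.infinite_compl.nontrivial
    refine hne (hinj τ σ hτ hσ 1 fun u => ?_)
    fin_cases u <;> simp [h0, h1, h2]
  · have hfin : (T ∪ ((p 0).roots.toFinset : Set K)).Finite := hT.union (Finset.finite_toSet _)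
    obtain ⟨τ, hτ, σ, hσ, hne⟩ := hfin.infinite_compl.nontrivial
    have hσ0 : (p 0).eval σ ≠ 0 := by
      intro hz
      refine hσ (Or.inr ?_)
      simpa [h0] using hz
    refine hne (hinj τ σ (fun hh => hτ (Or.inl hh)) (fun hh => hσ (Or.inl hh))
      ((p 0).eval τ / (p 0).eval σ) fun u => ?_)
    fin_cases u <;> simp [h1, h2, hσ0]

/-- Write the last two coordinates as `g a`, `g b` with `a, b` coprime. Projecting from the point
`(1 : 0 : 0)` shows that the degree of `F` in the first variable is at least the degree
of the pencil `a : b`. -/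
lemma max_natDegree_le_degreeOf [IsAlgClosed K] [CharZero K] (h : IsAffineParam n p F)
    {g a b : Polynomial K} (hg : g ≠ 0) (hab : IsCoprime a b) (h1 : p 1 = g * a)
    (h2 : p 2 = g * b) : max a.natDegree b.natDegree ≤ degreeOf 0 F := by
  classical
  obtain ⟨T, hT, hinj⟩ := h.generically_injective
  obtain ⟨B, hB, hfib⟩ := exists_generic_fibre hab
    (hT.union (Finset.finite_toSet g.roots.toFinset))
  have hF0 : finSuccEquiv K 2 F ≠ 0 := by
    simpa using h.irreducible.ne_zero
  have hle : degreeOf 0 F ≤ n :=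
    (degreeOf_le_totalDegree _ _).trans h.isHomogeneous.totalDegree_le
  have hlc := h.isHomogeneous.finSuccEquiv_coeff_isHomogeneous (degreeOf 0 F) (n - degreeOf 0 F)
    (by omega)
  have hlc0 : (finSuccEquiv K 2 F).coeff (degreeOf 0 F) ≠ 0 := by
    rw [← natDegree_finSuccEquiv]
    simpa using hF0
  obtain ⟨γ, hγ⟩ := (hB.union (finite_zeros_of_isHomogeneous hlc hlc0)).infinite_compl.nonempty
  obtain ⟨S, hS, hSr⟩ := hfib γ fun hh => hγ (Or.inl hh)
  set R := (finSuccEquiv K 2 F).map (eval ![γ, 1]) with hR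
  have hR0 : R ≠ 0 := by
    intro h0
    refine hγ (Or.inr ?_)
    have := congrArg (fun q => Polynomial.coeff q (degreeOf 0 F)) h0
    simpa [hR] using this
  have hgS : ∀ τ ∈ S, g.eval τ * b.eval τ ≠ 0 := by
    intro τ hτ
    obtain ⟨-, hb, hTτ⟩ := hSr τ hτ
    refine mul_ne_zero (fun hz => hTτ (Or.inr ?_)) hb
    simpa [hg] using hz
  have hcoord : ∀ τ ∈ S, (fun u => (p u).eval τ) = (g.eval τ * b.eval τ) •
      (Fin.cons ((p 0).eval τ / (g.eval τ * b.eval τ)) ![γ, 1] : Fin 3 → K) := by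
    intro τ hτ
    have hne := hgS τ hτ
    obtain ⟨ha, -, -⟩ := hSr τ hτ
    ext u
    fin_cases u
    · simp [mul_div_cancel₀ _ hne]
    · simp [h1, ha]
      ring
    · simp [h2]
  calc max a.natDegree b.natDegree = S.card := hS.symm
    _ ≤ R.roots.toFinset.card := by
      refine Finset.card_le_card_of_injOn
        (fun τ => (p 0).eval τ / (g.eval τ * b.eval τ)) (fun τ hτ => ?_)
        (fun τ hτ σ hσ heq => ?_)
      · simp only [Finset.mem_coe, Multiset.mem_toFinset, Polynomial.mem_roots hR0]
        have := h.eval_eq_zero τ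
        rw [hcoord τ hτ, eval_smul_of_isHomogeneous h.isHomogeneous, eval_cons_eq] at this
        exact (mul_eq_zero.1 this).resolve_left (pow_ne_zero _ (hgS τ hτ))
      · refine hinj τ σ (fun hh => (hSr τ hτ).2.2 (Or.inl hh))
          (fun hh => (hSr σ hσ).2.2 (Or.inl hh))
          (g.eval τ * b.eval τ / (g.eval σ * b.eval σ)) fun u => ?_
        have e1 := congrFun (hcoord τ hτ) u
        have e2 := congrFun (hcoord σ hσ) u
        have hne := hgS σ hσ
        dsimp only at e1 e2 heq
        rw [e1, e2, heq]
        simp only [Pi.smul_apply, smul_eq_mul]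
        rw [← mul_assoc, div_mul_cancel₀ _ hne]
    _ ≤ R.natDegree := (Multiset.toFinset_card_le _).trans (Polynomial.card_roots' _)
    _ ≤ (finSuccEquiv K 2 F).natDegree := Polynomial.natDegree_map_le
    _ = degreeOf 0 F := natDegree_finSuccEquiv F

end IsAffineParam

/-- Over a GCD domain, an irreducible polynomial and a nonzero polynomial of smaller degree
have a nonzero constant in the ideal they generate. -/
lemma exists_combination_eq_C {R : Type*} [CommRing R] [IsDomain R] [IsGCDMonoid R]
    {f h : Polynomial R} (hf : Irreducible f) (hh : h ≠ 0) (hlt : h.natDegree < f.natDegree) :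
    ∃ (A B : Polynomial R) (c : R), c ≠ 0 ∧ A * f + B * h = Polynomial.C c := by
  have hprim := hf.isPrimitive (by omega)
  have hirr := (hprim.irreducible_iff_irreducible_map_fraction_map (K := FractionRing R)).1 hf
  have hndvd : ¬ f.map (algebraMap R (FractionRing R)) ∣ h.map (algebraMap R (FractionRing R)) := by
    rw [← hprim.dvd_iff_fraction_map_dvd_fraction_map (FractionRing R)]
    intro hd
    exact absurd (Polynomial.natDegree_le_of_dvd hd hh) (by omega)
  obtain ⟨u, v, huv⟩ := hirr.coprime_iff_not_dvd.2 hndvd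
  obtain ⟨α, hα, hu⟩ := IsLocalization.integerNormalization_spec (nonZeroDivisors R) u
  obtain ⟨β, hβ, hv⟩ := IsLocalization.integerNormalization_spec (nonZeroDivisors R) v
  refine ⟨Polynomial.C β * IsLocalization.integerNormalization (nonZeroDivisors R) u,
    Polynomial.C α * IsLocalization.integerNormalization (nonZeroDivisors R) v, α * β,
    mul_ne_zero (nonZeroDivisors.ne_zero hα) (nonZeroDivisors.ne_zero hβ), ?_⟩
  apply Polynomial.map_injective _ (IsFractionRing.injective R (FractionRing R))
  have hsmul : ∀ (r : R) (q : Polynomial (FractionRing R)),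
      r • q = Polynomial.C (algebraMap R _ r) * q := by
    intro r q
    rw [← Polynomial.smul_eq_C_mul, algebraMap_smul]
  simp only [Polynomial.map_add, Polynomial.map_mul, Polynomial.map_C, hu, hv, hsmul, map_mul]
  linear_combination
    Polynomial.C (algebraMap R (FractionRing R) α) * Polynomial.C (algebraMap R _ β) * huv

namespace IsAffineParam

variable {K : Type*} [Field K] {n : ℕ} {p : Fin 3 → Polynomial K}
  {F : MvPolynomial (Fin 3) K}

/-- If the last two coordinates are `g a`, `g b` and `d` is the degree of the pencil `a : b`,
a dimension count yields a form of degree at most `d` in the first variable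
vanishing on the curve. -/
lemma exists_form_degreeOf_le {d : ℕ} {g a b : Polynomial K} (h0 : (p 0).natDegree ≤ n)
    (ha : a.natDegree ≤ d) (hb : b.natDegree ≤ d)
    (hgd : g.natDegree + d ≤ n) (h1 : p 1 = g * a) (h2 : p 2 = g * b) :
    ∃ (N : ℕ) (H : MvPolynomial (Fin 3) K), H ≠ 0 ∧ H.IsHomogeneous N ∧ degreeOf 0 H ≤ d ∧
      ∀ τ, eval (fun u => (p u).eval τ) H = 0 := by
  classical
  obtain ⟨k, rfl⟩ : ∃ k, n = d + k := ⟨n - d, by omega⟩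
  set N := d * (d + k) + 1 with hN
  have hdN : d ≤ N := by nlinarith [Nat.zero_le (d * k), Nat.le_mul_self d]
  set M := N * d + d * k with hM
  let ι := Fin (d + 1) × Fin (N - d + 1)
  let term : ι → Polynomial K := fun x =>
    p 0 ^ (x.1 : ℕ) * g ^ (d - x.1) * a ^ (x.2 : ℕ) * b ^ (N - x.1 - x.2)
  have hterm : ∀ x, (term x).natDegree ≤ M := by
    rintro ⟨⟨i, hi⟩, ⟨j, hj⟩⟩
    have e0 : (p 0 ^ i).natDegree ≤ i * (d + k) :=
      Polynomial.natDegree_pow_le_of_le i h0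
    have e1 : (g ^ (d - i)).natDegree ≤ (d - i) * k :=
      Polynomial.natDegree_pow_le_of_le _ (by omega)
    have e2 : (a ^ j).natDegree ≤ j * d := Polynomial.natDegree_pow_le_of_le _ ha
    have e3 : (b ^ (N - i - j)).natDegree ≤ (N - i - j) * d :=
      Polynomial.natDegree_pow_le_of_le _ hb
    refine (Polynomial.natDegree_mul_le_of_le (Polynomial.natDegree_mul_le_of_le
      (Polynomial.natDegree_mul_le_of_le e0 e1) e2) e3).trans (le_of_eq ?_)
    obtain ⟨i', rfl⟩ : ∃ i', d = i + i' := ⟨d - i, by omega⟩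
    obtain ⟨l, hl⟩ : ∃ l, N = i + j + l := ⟨N - i - j, by omega⟩
    rw [hM, hl, show i + i' - i = i' by omega, show i + j + l - i - j = l by omega]
    ring
  let Φ : (ι → K) →ₗ[K] Polynomial.degreeLT K (M + 1) :=
    LinearMap.codRestrict _ (Fintype.linearCombination K term) fun c => by
      rw [Fintype.linearCombination_apply]
      refine Submodule.sum_mem _ fun x _ => Submodule.smul_mem _ _ ?_
      rw [Polynomial.mem_degreeLT]
      exact lt_of_le_of_lt Polynomial.degree_le_natDegree
        (by exact_mod_cast Nat.lt_succ_of_le (hterm x))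
  have hfin : Module.finrank K (Polynomial.degreeLT K (M + 1)) = M + 1 := by
    rw [(Polynomial.degreeLTEquiv K (M + 1)).finrank_eq]
    simp
  have : FiniteDimensional K (Polynomial.degreeLT K (M + 1)) :=
    Module.Finite.equiv (Polynomial.degreeLTEquiv K (M + 1)).symm
  have hker : LinearMap.ker Φ ≠ ⊥ := by
    apply LinearMap.ker_ne_bot_of_finrank_lt
    rw [hfin, Module.finrank_fintype_fun_eq_card]
    simp only [ι, Fintype.card_prod, Fintype.card_fin]
    obtain ⟨l, hl⟩ : ∃ l, N = d + l := ⟨N - d, by omega⟩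
    rw [hM, hl, show d + l - d = l by omega]
    nlinarith
  obtain ⟨c, hc, hc0⟩ := Submodule.exists_mem_ne_zero_of_ne_bot hker
  have hc' : ∑ x, c x • term x = 0 := by
    have := congrArg Subtype.val (LinearMap.mem_ker.1 hc)
    simpa [Φ, Fintype.linearCombination_apply] using this
  let e : ι → (Fin 3 →₀ ℕ) := fun x =>
    Finsupp.equivFunOnFinite.symm ![(x.1 : ℕ), (x.2 : ℕ), N - x.1 - x.2]
  have he : Function.Injective e := by
    rintro ⟨⟨i, hi⟩, ⟨j, hj⟩⟩ ⟨⟨i', hi'⟩, ⟨j', hj'⟩⟩ heq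
    have q0 := DFunLike.congr_fun heq 0
    have q1 := DFunLike.congr_fun heq 1
    simp only [e, Finsupp.equivFunOnFinite_symm_apply_apply, Matrix.cons_val_zero,
      Matrix.cons_val_one] at q0 q1
    subst q0 q1
    rfl
  set H : MvPolynomial (Fin 3) K := ∑ x, monomial (e x) (c x) with hH
  have hcoeff : ∀ x, coeff (e x) H = c x := by
    intro x
    rw [hH, coeff_sum, Finset.sum_eq_single x (fun y _ hy => ?_) (by simp)]
    · rw [coeff_monomial, if_pos rfl]
    · rw [coeff_monomial, if_neg (he.ne hy)]
  refine ⟨N, H, ?_, ?_, ?_, fun τ => ?_⟩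
  · intro hz
    refine hc0 (funext fun x => ?_)
    rw [← hcoeff x, hz]
    simp
  · refine IsHomogeneous.sum _ _ _ fun x _ => isHomogeneous_monomial _ ?_
    obtain ⟨⟨i, hi⟩, ⟨j, hj⟩⟩ := x
    rw [Finsupp.degree_eq_sum]
    simp [e, Fin.sum_univ_three]
    omega
  · refine (degreeOf_sum_le _ _ _).trans (Finset.sup_le fun x _ => ?_)
    by_cases hcx : c x = 0
    · simp [hcx]
    · rw [degreeOf_monomial_eq _ _ hcx]
      have := x.1.isLt
      simp [e]
      omega
  · have hmon : ∀ x, eval (fun u => (p u).eval τ) (monomial (e x) (c x)) =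
        (g.eval τ) ^ (N - d) * (c x • term x).eval τ := by
      rintro ⟨⟨i, hi⟩, ⟨j, hj⟩⟩
      rw [eval_monomial, Finsupp.prod_fintype _ _ (by simp)]
      simp only [e, term, Fin.prod_univ_three, Finsupp.equivFunOnFinite_symm_apply_apply,
        Matrix.cons_val_zero, Matrix.cons_val_one, Matrix.cons_val, h1, h2, Polynomial.eval_mul,
        Polynomial.eval_pow, Polynomial.eval_smul, smul_eq_mul, mul_pow]
      obtain ⟨i', hi'⟩ : ∃ i', d = i + i' := ⟨d - i, by omega⟩
      obtain ⟨l, hl⟩ : ∃ l, N = i + j + l := ⟨N - i - j, by omega⟩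
      have hpow : (g.eval τ) ^ j * (g.eval τ) ^ (N - i - j) =
          (g.eval τ) ^ (N - d) * (g.eval τ) ^ (d - i) := by
        rw [← pow_add, ← pow_add]
        congr 1
        omega
      linear_combination c (⟨i, hi⟩, ⟨j, hj⟩) * (p 0).eval τ ^ i * a.eval τ ^ j
        * b.eval τ ^ (N - i - j) * hpow
    rw [hH, map_sum, Finset.sum_congr rfl fun x _ => hmon x, ← Finset.mul_sum,
      ← Polynomial.eval_finsetSum, hc']
    simp

/-- If the last two coordinates are `g a`, `g b` with `a, b` coprime, the pencil `a : b` is not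
constant: otherwise the curve would be a line. -/
lemma max_natDegree_pos [Infinite K] (h : IsAffineParam n p F) (hn : 2 ≤ n)
    {g a b : Polynomial K} (hg : g ≠ 0) (hab : IsCoprime a b) (h1 : p 1 = g * a)
    (h2 : p 2 = g * b) : 0 < max a.natDegree b.natDegree := by
  classical
  by_contra hle
  obtain ⟨α, rfl⟩ := Polynomial.natDegree_eq_zero.1
    (show a.natDegree = 0 by omega)
  obtain ⟨β, rfl⟩ := Polynomial.natDegree_eq_zero.1
    (show b.natDegree = 0 by omega)
  obtain ⟨u, v, huv⟩ := hab
  set x := u.eval 0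
  set y := v.eval 0
  have hxy : x * α + y * β = 1 := by
    simpa using congrArg (Polynomial.eval 0) huv
  obtain ⟨T, hT, hinj⟩ := h.generically_injective
  have hfin : (T ∪ (g.roots.toFinset : Set K)).Finite := hT.union (Finset.finite_toSet _)
  have hgne : ∀ τ, τ ∈ (T ∪ (g.roots.toFinset : Set K))ᶜ → g.eval τ ≠ 0 := by
    intro τ hτ hz
    refine hτ (Or.inr ?_)
    simpa [hg] using hz
  have hcoord : ∀ τ, τ ∈ (T ∪ (g.roots.toFinset : Set K))ᶜ → (fun u => (p u).eval τ) =
      g.eval τ • (Fin.cons ((p 0).eval τ / g.eval τ) ![α, β] : Fin 3 → K) := by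
    intro τ hτ
    have hne := hgne τ hτ
    ext w
    fin_cases w
    · simp [mul_div_cancel₀ _ hne]
    · simp [h1]
    · simp [h2]
  have hR : (finSuccEquiv K 2 F).map (eval ![α, β]) = 0 := by
    refine Polynomial.eq_zero_of_infinite_isRoot _ ?_
    refine (Set.Infinite.image (f := fun τ => (p 0).eval τ / g.eval τ) ?_
      hfin.infinite_compl).mono ?_
    · intro τ hτ σ hσ heq
      refine hinj τ σ (fun hh => hτ (Or.inl hh)) (fun hh => hσ (Or.inl hh))
        (g.eval τ / g.eval σ) fun w => ?_
      have e1 := congrFun (hcoord τ hτ) w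
      have e2 := congrFun (hcoord σ hσ) w
      dsimp only at e1 e2 heq
      rw [e1, e2, heq]
      simp only [Pi.smul_apply, smul_eq_mul]
      rw [← mul_assoc, div_mul_cancel₀ _ (hgne σ hσ)]
    · rintro _ ⟨τ, hτ, rfl⟩
      have := h.eval_eq_zero τ
      rw [hcoord τ hτ, eval_smul_of_isHomogeneous h.isHomogeneous, eval_cons_eq] at this
      exact (mul_eq_zero.1 this).resolve_left (pow_ne_zero _ (hgne τ hτ))
  set m : MvPolynomial (Fin 3) K := C x * X 1 + C y * X 2 with hm
  set L : MvPolynomial (Fin 3) K := C β * X 1 - C α * X 2 with hL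
  set G : MvPolynomial (Fin 3) K := aeval ![X 0, C α * m, C β * m] F with hG
  have hm0 : m ≠ 0 := by
    intro hz
    have := congrArg (eval ![0, α, β]) hz
    simp [hm, hxy] at this
  have hG0 : G = 0 := by
    refine (mul_eq_zero.1 ?_).resolve_right hm0
    refine MvPolynomial.funext fun w => ?_
    by_cases hw : eval w m = 0
    · simp [hw]
    have hGw : eval w G = eval ![w 0, α * eval w m, β * eval w m] F := by
      have : (aeval w).comp (aeval ![X 0, C α * m, C β * m]) =
          aeval (R := K) ![w 0, α * eval w m, β * eval w m] := by
        ext i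
        fin_cases i <;> simp [aeval_eq_eval]
      have := DFunLike.congr_fun this F
      rw [AlgHom.comp_apply, ← hG] at this
      simpa [aeval_eq_eval] using this
    have hpt : ![w 0, α * eval w m, β * eval w m] =
        eval w m • (Fin.cons (w 0 / eval w m) ![α, β] : Fin 3 → K) := by
      ext i
      fin_cases i
      · simp [mul_div_cancel₀ _ hw]
      · simp [mul_comm]
      · simp [mul_comm]
    rw [map_mul, hGw, hpt, eval_smul_of_isHomogeneous h.isHomogeneous, eval_cons_eq, hR]
    simp
  have hdvd : L ∣ F := by
    have hx1 : X 1 - C α * m = C y * L := by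
      have := congrArg (C (σ := Fin 3)) hxy
      simp only [map_add, map_mul, map_one] at this
      simp only [hm, hL]
      linear_combination (-X 1) * this
    have hx2 : X 2 - C β * m = -C x * L := by
      have := congrArg (C (σ := Fin 3)) hxy
      simp only [map_add, map_mul, map_one] at this
      simp only [hm, hL]
      linear_combination (-X 2) * this
    have key : (Ideal.Quotient.mkₐ K (Ideal.span {L})).comp
        (aeval ![X 0, C α * m, C β * m]) = Ideal.Quotient.mkₐ K (Ideal.span {L}) := by
      ext i
      fin_cases i
      · simp
      · simp only [AlgHom.comp_apply, aeval_X]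
        refine (Ideal.Quotient.eq.2 (Ideal.mem_span_singleton.2 ?_)).symm
        exact hx1 ▸ Dvd.intro_left _ rfl
      · simp only [AlgHom.comp_apply, aeval_X]
        refine (Ideal.Quotient.eq.2 (Ideal.mem_span_singleton.2 ?_)).symm
        exact hx2 ▸ Dvd.intro_left _ rfl
    have hq := DFunLike.congr_fun key F
    rw [AlgHom.comp_apply, ← hG, hG0, map_zero] at hq
    exact Ideal.mem_span_singleton.1 (Ideal.Quotient.eq_zero_iff_mem.1 hq.symm)
  have hL1 : L.IsHomogeneous 1 :=
    ((isHomogeneous_C_mul_X _ _).sub (isHomogeneous_C_mul_X _ _))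
  have hL0 : L ≠ 0 := fun hz => h.irreducible.ne_zero (zero_dvd_iff.1 (hz ▸ hdvd))
  have hLunit : ¬ IsUnit L := by
    intro hu
    have := hL1.totalDegree hL0
    rw [(isUnit_iff_totalDegree_of_isReduced.1 hu).2] at this
    omega
  have hassoc := (h.irreducible.dvd_iff.1 hdvd).resolve_left hLunit
  have hFL : F ∣ L := hassoc.dvd
  have := totalDegree_le_of_dvd_of_isDomain hFL hL0
  rw [h.isHomogeneous.totalDegree h.irreducible.ne_zero, hL1.totalDegree hL0] at this
  omega

/-- If the last two coordinates are `g a`, `g b` with `a, b` coprime, the degree of `F` in the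
first variable is at most the degree of the pencil `a : b`. -/
lemma degreeOf_le_max_natDegree [IsAlgClosed K] [CharZero K] (h : IsAffineParam n p F)
    (hn : 2 ≤ n) {g a b : Polynomial K} (hg : g ≠ 0) (hab : IsCoprime a b) (h1 : p 1 = g * a)
    (h2 : p 2 = g * b) (hgd : g.natDegree + max a.natDegree b.natDegree ≤ n) :
    degreeOf 0 F ≤ max a.natDegree b.natDegree := by
  classical
  have hpos := h.max_natDegree_pos hn hg hab h1 h2
  by_contra hlt
  rw [not_le] at hlt
  obtain ⟨N, H, hH0, hHhom, hHd, hHe⟩ := exists_form_degreeOf_le (h.natDegree_le 0)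
    (le_max_left _ _) (le_max_right _ _) hgd h1 h2
  obtain ⟨A, B, c, hc, hAB⟩ := exists_combination_eq_C
    ((MulEquiv.irreducible_iff (finSuccEquiv K 2)).2 h.irreducible)
    (h := finSuccEquiv K 2 H) (by simpa using hH0)
    (by rw [natDegree_finSuccEquiv, natDegree_finSuccEquiv]; omega)
  obtain ⟨S, hS, hfib⟩ := exists_generic_fibre hab (Finset.finite_toSet g.roots.toFinset)
  have hvan : ∀ w : Fin 2 → K, w 1 ≠ 0 → w 0 / w 1 ∉ S → eval w c = 0 := by
    intro w hw hwS
    obtain ⟨Z, hZ, hZr⟩ := hfib _ hwS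
    obtain ⟨τ, hτ⟩ := Finset.card_pos.1 (hZ ▸ hpos)
    obtain ⟨ha, hb, hgτ⟩ := hZr τ hτ
    have hgτ' : g.eval τ ≠ 0 := fun hz => hgτ (by simpa [hg] using hz)
    set t := w 1 / (g.eval τ * b.eval τ) with ht
    have hpt : (Fin.cons (t * (p 0).eval τ) w : Fin 3 → K) = t • fun u => (p u).eval τ := by
      ext u
      fin_cases u
      · simp
      · simp [h1, ha, ht]
        field_simp
      · change w 1 = t * (p 2).eval τ
        simp [h2, ht]
        field_simp
    have eF : eval (Fin.cons (t * (p 0).eval τ) w : Fin 3 → K) F = 0 := by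
      rw [hpt, eval_smul_of_isHomogeneous h.isHomogeneous, h.eval_eq_zero, mul_zero]
    have eH : eval (Fin.cons (t * (p 0).eval τ) w : Fin 3 → K) H = 0 := by
      rw [hpt, eval_smul_of_isHomogeneous hHhom, hHe, mul_zero]
    rw [eval_cons_eq] at eF eH
    have := congrArg (fun q => (q.map (eval w)).eval (t * (p 0).eval τ)) hAB
    simpa [eF, eH] using this.symm
  have hprod : c * (X 1 * ∏ γ ∈ hS.toFinset, (X 0 - C γ * X 1)) = 0 := by
    refine MvPolynomial.funext fun w => ?_
    by_cases hw : w 1 = 0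
    · simp [hw]
    by_cases hwS : w 0 / w 1 ∈ S
    · simp only [map_mul, map_prod, map_zero]
      rw [Finset.prod_eq_zero (hS.mem_toFinset.2 hwS)]
      · simp
      · simp [div_mul_cancel₀ _ hw]
    · rw [map_mul, hvan w hw hwS, zero_mul, map_zero]
  refine hc ((mul_eq_zero.1 hprod).resolve_right (mul_ne_zero (X_ne_zero _) ?_))
  refine Finset.prod_ne_zero_iff.2 fun γ _ hz => ?_
  have := congrArg (eval ![1, 0]) hz
  simp at this

end IsAffineParam

/-- The ideal of polynomials all of whose monomials have weight at least `k`. -/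
def weightIdeal {K σ : Type*} [Field K] (w : (σ →₀ ℕ) →+ ℕ) (k : ℕ) :
    Ideal (MvPolynomial σ K) where
  carrier := {G | ∀ e, coeff e G ≠ 0 → k ≤ w e}
  zero_mem' := by simp
  add_mem' := by
    intro G H hG hH e he
    rw [coeff_add] at he
    by_cases h : coeff e G = 0
    · exact hH e fun h' => he (by rw [h, h', add_zero])
    · exact hG e h
  smul_mem' := by
    classical
    intro A G hG e he
    rw [smul_eq_mul, coeff_mul] at he
    obtain ⟨x, hx, hx0⟩ := Finset.exists_ne_zero_of_sum_ne_zero he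
    rw [← Finset.HasAntidiagonal.mem_antidiagonal.1 hx, map_add]
    exact (hG x.2 (right_ne_zero_of_mul hx0)).trans (Nat.le_add_left _ _)

lemma weightIdeal_mul_le {K σ : Type*} [Field K] (w : (σ →₀ ℕ) →+ ℕ) (k l : ℕ) :
    weightIdeal (K := K) w k * weightIdeal w l ≤ weightIdeal w (k + l) := by
  classical
  refine Ideal.mul_le.2 fun G hG H hH e he => ?_
  rw [coeff_mul] at he
  obtain ⟨x, hx, hx0⟩ := Finset.exists_ne_zero_of_sum_ne_zero he
  rw [← Finset.HasAntidiagonal.mem_antidiagonal.1 hx, map_add]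
  exact add_le_add (hG x.1 (left_ne_zero_of_mul hx0)) (hH x.2 (right_ne_zero_of_mul hx0))

lemma pow_le_weightIdeal {K σ : Type*} [Field K] (w : (σ →₀ ℕ) →+ ℕ)
    {I : Ideal (MvPolynomial σ K)} (hI : I ≤ weightIdeal w 1) (m : ℕ) :
    I ^ m ≤ weightIdeal w m := by
  induction m with
  | zero => exact fun G _ e _ => Nat.zero_le _
  | succ m ih =>
    rw [pow_succ]
    exact (Ideal.mul_mono ih hI).trans (weightIdeal_mul_le w m 1)

/-- The order of a nonzero form of degree `n` at a point is at least two exactly when the form lies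
in the square of the ideal of the point. -/
lemma two_le_multAt_iff {K : Type*} [Field K] {F : MvPolynomial (Fin 3) K} {n : ℕ}
    (hF : F.IsHomogeneous n) (hF0 : F ≠ 0) (P : Fin 3 → K) :
    2 ≤ multAt F P ↔ F ∈ pointIdeal P ^ 2 := by
  have hI : pointIdeal P ≤ weightIdeal Finsupp.degree 1 := by
    refine Ideal.span_le.2 fun L hL e he => ?_
    by_contra hlt
    exact he (hL.1.coeff_eq_zero (by omega))
  have hbdd : BddAbove {m | F ∈ pointIdeal P ^ m} := by
    refine ⟨n, fun m hm => ?_⟩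
    obtain ⟨e, he⟩ := exists_coeff_ne_zero hF0
    have h1 := pow_le_weightIdeal _ hI m hm e he
    by_contra hlt
    exact he (hF.coeff_eq_zero (by omega))
  constructor
  · intro h
    have hmem := Nat.sSup_mem ⟨0, by simp⟩ hbdd
    exact Ideal.pow_le_pow_right h hmem
  · exact fun h => le_csSup hbdd h

lemma exists_eq_sum_of_isHomogeneous_one {K σ : Type*} [Field K] [Fintype σ]
    {L : MvPolynomial σ K} (hL : L.IsHomogeneous 1) : ∃ c : σ → K, L = ∑ i, C (c i) * X i := by
  have : L ∈ homogeneousSubmodule σ K 1 := hL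
  rw [homogeneousSubmodule_one_eq_span_X] at this
  obtain ⟨c, hc⟩ := (Submodule.mem_span_range_iff_exists_fun K).1 this
  exact ⟨c, by rw [← hc]; simp [smul_eq_C_mul]⟩

/-- A form of degree `n` has order at least two at `(1 : 0 : 0)` exactly when its degree in the first
variable is at most `n - 2`. -/
lemma mem_pointIdeal_single_sq_iff {K : Type*} [Field K] {F : MvPolynomial (Fin 3) K} {n : ℕ}
    (hn : 2 ≤ n) (hF : F.IsHomogeneous n) :
    F ∈ pointIdeal (Pi.single 0 1) ^ 2 ↔ degreeOf 0 F ≤ n - 2 := by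
  have hsum : ∀ e, coeff e F ≠ 0 → e 0 + e 1 + e 2 = n := by
    intro e he
    by_contra hne
    refine he (hF.coeff_eq_zero ?_)
    rwa [Finsupp.degree_eq_sum, Fin.sum_univ_three]
  have hX : ∀ i : Fin 3, i ≠ 0 → (X i : MvPolynomial (Fin 3) K) ∈ pointIdeal (Pi.single 0 1) :=
    fun i hi => Ideal.subset_span ⟨isHomogeneous_X _ _, by simp [hi]⟩
  rw [degreeOf_le_iff]
  constructor
  · intro h e he
    let w : (Fin 3 →₀ ℕ) →+ ℕ := Finsupp.applyAddHom 1 + Finsupp.applyAddHom 2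
    have hXw : ∀ i : Fin 3, i ≠ 0 → (X i : MvPolynomial (Fin 3) K) ∈ weightIdeal w 1 := by
      classical
      intro i hi e he
      have hei : Finsupp.single i 1 = e := by
        by_contra hne
        exact he (by rw [coeff_X, if_neg hne])
      subst hei
      fin_cases i
      · exact absurd rfl hi
      · simp [w]
      · simp [w]
    have hI : pointIdeal (Pi.single (M := fun _ => K) 0 1) ≤ weightIdeal w 1 := by
      refine Ideal.span_le.2 ?_
      rintro L ⟨hL, hL0⟩
      obtain ⟨c, rfl⟩ := exists_eq_sum_of_isHomogeneous_one hL
      have hc : c 0 = 0 := by simpa [Fin.sum_univ_three] using hL0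
      rw [Fin.sum_univ_three, hc]
      simp only [map_zero, zero_mul, zero_add]
      exact Ideal.add_mem _ (Ideal.mul_mem_left _ _ (hXw 1 (by decide)))
        (Ideal.mul_mem_left _ _ (hXw 2 (by decide)))
    have h1 := pow_le_weightIdeal w hI 2 h e (mem_support_iff.1 he)
    have h2 := hsum e (mem_support_iff.1 he)
    simp only [w, AddMonoidHom.add_apply, Finsupp.applyAddHom_apply] at h1
    omega
  · intro h
    rw [F.as_sum]
    refine Ideal.sum_mem _ fun e he => ?_
    have h1 := h e he
    have h2 := hsum e (mem_support_iff.1 he)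
    rw [monomial_eq, Finsupp.prod_fintype _ _ (by simp), Fin.prod_univ_three, mul_assoc]
    refine Ideal.mul_mem_left _ _ (Ideal.mul_mem_left _ _ ?_)
    refine Ideal.pow_le_pow_right (show 2 ≤ e 1 + e 2 by omega) ?_
    rw [pow_add]
    exact Ideal.mul_mem_mul (Ideal.pow_mem_pow (hX 1 (by decide)) _)
      (Ideal.pow_mem_pow (hX 2 (by decide)) _)

/-- The forms `∑ c_u p_u` with `∑ c_u P_u = 0`, of formal degree `n`, are all divisible by the
quadratic form that dehomogenizes to `q`. -/
def CrossDvd {K : Type*} [Field K] (n : ℕ) (p : Fin 3 → Polynomial K) (q : Polynomial K)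
    (P : Fin 3 → K) : Prop :=
  ∀ c : Fin 3 → K, ∑ u, c u * P u = 0 →
    ∃ r : Polynomial K, r.natDegree ≤ n - 2 ∧ ∑ u, Polynomial.C (c u) * p u = q * r

lemma crossDvd_single_iff {K : Type*} [Field K] {n : ℕ} {p : Fin 3 → Polynomial K}
    {q : Polynomial K} : CrossDvd n p q (Pi.single 0 1) ↔
      (∃ r : Polynomial K, r.natDegree ≤ n - 2 ∧ p 1 = q * r) ∧
      (∃ r : Polynomial K, r.natDegree ≤ n - 2 ∧ p 2 = q * r) := by
  constructor
  · intro h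
    exact ⟨by simpa [Fin.sum_univ_three] using h ![0, 1, 0] (by simp [Fin.sum_univ_three]),
      by simpa [Fin.sum_univ_three] using h ![0, 0, 1] (by simp [Fin.sum_univ_three])⟩
  · rintro ⟨⟨r, hr, h1⟩, s, hs, h2⟩ c hc
    have hc0 : c 0 = 0 := by simpa [Fin.sum_univ_three] using hc
    refine ⟨Polynomial.C (c 1) * r + Polynomial.C (c 2) * s, ?_, ?_⟩
    · exact Polynomial.natDegree_add_le_of_degree_le
        ((Polynomial.natDegree_C_mul_le _ _).trans hr)
        ((Polynomial.natDegree_C_mul_le _ _).trans hs)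
    · rw [Fin.sum_univ_three, hc0, h1, h2, map_zero]
      ring

/-- Over an algebraically closed field, every nonzero polynomial has a factor of degree
`min 2 (natDegree g)`. -/
lemma exists_factor_natDegree_min_two {K : Type*} [Field K] [IsAlgClosed K] {g : Polynomial K}
    (hg : g ≠ 0) : ∃ q s : Polynomial K, g = q * s ∧ q ≠ 0 ∧ q.natDegree = min 2 g.natDegree := by
  rcases lt_or_ge g.natDegree 2 with h | h
  · exact ⟨g, 1, by simp, hg, by omega⟩
  · obtain ⟨x, hx⟩ := IsAlgClosed.exists_root g
      (fun h0 => by have := Polynomial.natDegree_eq_zero_iff_degree_le_zero.2 h0.le; omega)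
    obtain ⟨g', rfl⟩ := Polynomial.dvd_iff_isRoot.2 hx
    have hg' : g' ≠ 0 := right_ne_zero_of_mul hg
    have hdeg : g'.natDegree + 1 = ((Polynomial.X - Polynomial.C x) * g').natDegree := by
      rw [Polynomial.natDegree_mul (Polynomial.X_sub_C_ne_zero x) hg', Polynomial.natDegree_X_sub_C,
        add_comm]
    obtain ⟨y, hy⟩ := IsAlgClosed.exists_root g'
      (fun h0 => by have := Polynomial.natDegree_eq_zero_iff_degree_le_zero.2 h0.le; omega)
    obtain ⟨s, rfl⟩ := Polynomial.dvd_iff_isRoot.2 hy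
    refine ⟨(Polynomial.X - Polynomial.C x) * (Polynomial.X - Polynomial.C y), s, by ring,
      mul_ne_zero (Polynomial.X_sub_C_ne_zero x) (Polynomial.X_sub_C_ne_zero y), ?_⟩
    rw [Polynomial.natDegree_mul (Polynomial.X_sub_C_ne_zero x) (Polynomial.X_sub_C_ne_zero y),
      Polynomial.natDegree_X_sub_C, Polynomial.natDegree_X_sub_C]
    omega

/-- The singularity criterion at the point `(1 : 0 : 0)`. -/
lemma IsAffineParam.mem_pointIdeal_single_sq_iff {K : Type*} [Field K] [IsAlgClosed K] [CharZero K]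
    {n : ℕ} {p : Fin 3 → Polynomial K} {F : MvPolynomial (Fin 3) K} (h : IsAffineParam n p F)
    (hn : 2 ≤ n) : F ∈ pointIdeal (Pi.single 0 1) ^ 2 ↔
      ∃ q : Polynomial K, q ≠ 0 ∧ q.natDegree ≤ 2 ∧ CrossDvd n p q (Pi.single 0 1) := by
  classical
  rw [_root_.mem_pointIdeal_single_sq_iff hn h.isHomogeneous]
  simp only [crossDvd_single_iff]
  obtain ⟨a, b, h1, h2, hu⟩ := extract_gcd (p 1) (p 2)
  set g := gcd (p 1) (p 2) with hg_def
  have hg : g ≠ 0 := fun hz => h.not_both_zero ((gcd_eq_zero_iff _ _).1 hz)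
  have hab : IsCoprime a b := (gcd_isUnit_iff a b).1 hu
  have hdega : a ≠ 0 → g.natDegree + a.natDegree ≤ n := by
    intro ha
    rw [← Polynomial.natDegree_mul hg ha, ← h1]
    exact h.natDegree_le 1
  have hdegb : b ≠ 0 → g.natDegree + b.natDegree ≤ n := by
    intro hb
    rw [← Polynomial.natDegree_mul hg hb, ← h2]
    exact h.natDegree_le 2
  have hgd : g.natDegree + max a.natDegree b.natDegree ≤ n := by
    by_cases ha : a = 0
    · have hb : b ≠ 0 := by
        rintro rfl
        exact h.not_both_zero ⟨by rw [h1, ha, mul_zero], by rw [h2, mul_zero]⟩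
      have := hdegb hb
      simp [ha]
      omega
    · have := hdega ha
      by_cases hb : b = 0
      · simp [hb]
        omega
      · have := hdegb hb
        omega
  rw [le_antisymm (h.degreeOf_le_max_natDegree hn hg hab h1 h2 hgd)
    (h.max_natDegree_le_degreeOf hg hab h1 h2)]
  constructor
  · intro hd
    obtain ⟨q, s, hqs, hq, hqd⟩ := exists_factor_natDegree_min_two hg
    have hs : s ≠ 0 := by
      rintro rfl
      exact hg (by rw [hqs, mul_zero])
    have hsd : g.natDegree = q.natDegree + s.natDegree := by
      rw [hqs, Polynomial.natDegree_mul hq hs]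
    have hbound : ∀ c : Polynomial K, c.natDegree ≤ max a.natDegree b.natDegree →
        (s * c).natDegree ≤ n - 2 := by
      intro c hc
      have := Polynomial.natDegree_mul_le (p := s) (q := c)
      omega
    exact ⟨q, hq, by omega, ⟨s * a, hbound a (le_max_left _ _), by rw [h1, hqs]; ring⟩,
      ⟨s * b, hbound b (le_max_right _ _), by rw [h2, hqs]; ring⟩⟩
  · rintro ⟨q, hq, -, ⟨r, hr, hr1⟩, ⟨s, hs, hs2⟩⟩
    obtain ⟨t, ht⟩ : q ∣ g := dvd_gcd ⟨r, hr1⟩ ⟨s, hs2⟩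
    have ht0 : t ≠ 0 := by
      rintro rfl
      exact hg (by rw [ht, mul_zero])
    have hbound : ∀ c r : Polynomial K, q * t * c = q * r → r.natDegree ≤ n - 2 →
        c.natDegree ≤ n - 2 := by
      intro c r hcr hr
      rw [mul_assoc] at hcr
      rw [← mul_left_cancel₀ hq hcr] at hr
      by_cases hc : c = 0
      · simp [hc]
      · rw [Polynomial.natDegree_mul ht0 hc] at hr
        omega
    exact max_le (hbound a r (by rw [← ht, ← h1, hr1]) hr) (hbound b s (by rw [← ht, ← h2, hs2]) hs)

/-- Substitution of the coordinates of a linear map in a polynomial. -/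
def linSubst {K : Type*} [Field K] (e : (Fin 3 → K) →ₗ[K] (Fin 3 → K)) :
    MvPolynomial (Fin 3) K →ₐ[K] MvPolynomial (Fin 3) K :=
  aeval fun i => ∑ j, C (e (Pi.single j 1) i) * X j

lemma sum_apply_single_mul {K : Type*} [Field K] (e : (Fin 3 → K) →ₗ[K] (Fin 3 → K))
    (v : Fin 3 → K) (i : Fin 3) : ∑ j, e (Pi.single j 1) i * v j = e v i := by
  conv_rhs => rw [pi_eq_sum_univ' v, map_sum, Finset.sum_apply]
  refine Finset.sum_congr rfl fun j _ => ?_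
  rw [map_smul, Pi.smul_apply, smul_eq_mul, mul_comm]

lemma eval_linSubst {K : Type*} [Field K] (e : (Fin 3 → K) →ₗ[K] (Fin 3 → K))
    (F : MvPolynomial (Fin 3) K) (v : Fin 3 → K) : eval v (linSubst e F) = eval (e v) F := by
  have : (aeval v).comp (linSubst e) = aeval (R := K) (e v) := by
    ext i
    simp [linSubst, ← sum_apply_single_mul e v i]
  simpa using DFunLike.congr_fun this F

lemma linSubst_symm_linSubst {K : Type*} [Field K] [Infinite K]
    (e : (Fin 3 → K) ≃ₗ[K] (Fin 3 → K)) (F : MvPolynomial (Fin 3) K) :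
    linSubst (e.symm : (Fin 3 → K) →ₗ[K] (Fin 3 → K)) (linSubst (e : _ →ₗ[K] _) F) = F := by
  refine MvPolynomial.funext fun v => ?_
  rw [eval_linSubst, eval_linSubst]
  simp

lemma isHomogeneous_linSubst {K : Type*} [Field K] (e : (Fin 3 → K) →ₗ[K] (Fin 3 → K))
    {F : MvPolynomial (Fin 3) K} {n : ℕ} (hF : F.IsHomogeneous n) :
    (linSubst e F).IsHomogeneous n := by
  have := hF.aeval (S := K) (n := 1) (fun i => ∑ j, C (e (Pi.single j 1) i) * X j)
    (fun i => IsHomogeneous.sum _ _ _ fun j _ => by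
      simpa using (isHomogeneous_C (Fin 3) (e (Pi.single j 1) i)).mul (isHomogeneous_X K j))
  rwa [one_mul] at this

lemma irreducible_linSubst {K : Type*} [Field K] [Infinite K]
    (e : (Fin 3 → K) ≃ₗ[K] (Fin 3 → K)) {F : MvPolynomial (Fin 3) K} (hF : Irreducible F) :
    Irreducible (linSubst (e : _ →ₗ[K] _) F) := by
  refine (MulEquiv.irreducible_iff (MulEquiv.ofBijective
    (linSubst (e : (Fin 3 → K) →ₗ[K] _)) ⟨?_, fun G => ⟨linSubst (e.symm : _ →ₗ[K] _) G, ?_⟩⟩)).2 hF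
  · exact Function.LeftInverse.injective (linSubst_symm_linSubst e)
  · simpa using linSubst_symm_linSubst e.symm G

lemma linSubst_mem_pointIdeal_pow {K : Type*} [Field K] (e : (Fin 3 → K) →ₗ[K] (Fin 3 → K))
    {F : MvPolynomial (Fin 3) K} {P : Fin 3 → K} {m : ℕ} (hF : F ∈ pointIdeal (e P) ^ m) :
    linSubst e F ∈ pointIdeal P ^ m := by
  have hle : (pointIdeal (e P)).map (linSubst e) ≤ pointIdeal P := by
    rw [pointIdeal, Ideal.map_span, Ideal.span_le]
    rintro _ ⟨L, hL, rfl⟩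
    exact Ideal.subset_span ⟨isHomogeneous_linSubst e hL.1, by
      rw [eval_linSubst, hL.2]⟩
  refine Ideal.pow_right_mono hle m ?_
  rw [← Ideal.map_pow]
  exact Ideal.mem_map_of_mem _ hF

/-- The composition of a parameterization with a linear map. -/
def linComp {K : Type*} [Field K] (e : (Fin 3 → K) →ₗ[K] (Fin 3 → K))
    (p : Fin 3 → Polynomial K) (u : Fin 3) : Polynomial K :=
  ∑ j, Polynomial.C (e (Pi.single j 1) u) * p j

lemma eval_linComp {K : Type*} [Field K] (e : (Fin 3 → K) →ₗ[K] (Fin 3 → K))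
    (p : Fin 3 → Polynomial K) (τ : K) :
    (fun u => (linComp e p u).eval τ) = e fun u => (p u).eval τ := by
  ext u
  rw [← sum_apply_single_mul]
  simp [linComp, Polynomial.eval_finsetSum]

lemma linComp_symm_linComp {K : Type*} [Field K] [Infinite K]
    (e : (Fin 3 → K) ≃ₗ[K] (Fin 3 → K)) (p : Fin 3 → Polynomial K) :
    linComp (e.symm : _ →ₗ[K] (Fin 3 → K)) (linComp (e : _ →ₗ[K] (Fin 3 → K)) p) = p := by
  refine _root_.funext fun u => Polynomial.funext fun τ => ?_
  have := congrFun (eval_linComp (e.symm : _ →ₗ[K] (Fin 3 → K)) (linComp (e : _ →ₗ[K] _) p) τ) u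
  rw [eval_linComp] at this
  simpa using this

lemma CrossDvd.linComp {K : Type*} [Field K] (e : (Fin 3 → K) →ₗ[K] (Fin 3 → K)) {n : ℕ}
    {p : Fin 3 → Polynomial K} {q : Polynomial K} {P : Fin 3 → K} (h : CrossDvd n p q P) :
    CrossDvd n (linComp e p) q (e P) := by
  intro c hc
  obtain ⟨r, hr, hrq⟩ := h (fun j => ∑ u, c u * e (Pi.single j 1) u) (by
    rw [← hc]
    simp only [← sum_apply_single_mul e P, Finset.mul_sum, Finset.sum_mul]
    rw [Finset.sum_comm]
    exact Finset.sum_congr rfl fun _ _ => Finset.sum_congr rfl fun _ _ => by ring)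
  refine ⟨r, hr, hrq ▸ ?_⟩
  simp only [_root_.linComp, Finset.mul_sum, Finset.sum_mul, map_sum, map_mul]
  rw [Finset.sum_comm]
  exact Finset.sum_congr rfl fun _ _ => Finset.sum_congr rfl fun _ _ => by ring

lemma IsAffineParam.linComp {K : Type*} [Field K] [Infinite K]
    (e : (Fin 3 → K) ≃ₗ[K] (Fin 3 → K)) {n : ℕ} {p : Fin 3 → Polynomial K}
    {F : MvPolynomial (Fin 3) K} (h : IsAffineParam n p F) :
    IsAffineParam n (linComp (e : _ →ₗ[K] _) p) (linSubst (e.symm : _ →ₗ[K] _) F) where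
  natDegree_le u := Polynomial.natDegree_sum_le_of_forall_le _ _ fun j _ =>
    (Polynomial.natDegree_C_mul_le _ _).trans (h.natDegree_le j)
  generically_injective := by
    obtain ⟨T, hT, hinj⟩ := h.generically_injective
    refine ⟨T, hT, fun τ σ hτ hσ c hc => hinj τ σ hτ hσ c fun u => ?_⟩
    have h1 : (fun u => (_root_.linComp (e : _ →ₗ[K] _) p u).eval τ)
        = c • fun u => (_root_.linComp (e : _ →ₗ[K] _) p u).eval σ := _root_.funext hc
    rw [eval_linComp, eval_linComp, ← map_smul] at h1
    exact congrFun (e.injective h1) u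
  irreducible := irreducible_linSubst e.symm h.irreducible
  isHomogeneous := isHomogeneous_linSubst _ h.isHomogeneous
  eval_eq_zero τ := by
    rw [eval_linSubst, eval_linComp]
    simpa using h.eval_eq_zero τ

lemma exists_linearEquiv_apply_eq {K V : Type*} [Field K] [AddCommGroup V] [Module K V]
    {v w : V} (hv : v ≠ 0) (hw : w ≠ 0) : ∃ e : V ≃ₗ[K] V, e v = w := by
  obtain ⟨e, he⟩ := Submodule.exists_linearEquiv_restrict_eq
    ((LinearEquiv.toSpanNonzeroSingleton K V v hv).symm ≪≫ₗ
      LinearEquiv.toSpanNonzeroSingleton K V w hw)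
  refine ⟨e, ?_⟩
  have := he (LinearEquiv.toSpanNonzeroSingleton K V v hv 1)
  rw [LinearEquiv.trans_apply, LinearEquiv.symm_apply_apply] at this
  simpa using this.symm

/-- The singular points of a rational curve are the points `P` such that the pullbacks of the
lines through `P` have a common factor of degree two. -/
lemma IsAffineParam.mem_pointIdeal_sq_iff {K : Type*} [Field K] [IsAlgClosed K] [CharZero K]
    {n : ℕ} {p : Fin 3 → Polynomial K} {F : MvPolynomial (Fin 3) K} (h : IsAffineParam n p F)
    (hn : 2 ≤ n) {P : Fin 3 → K} (hP : P ≠ 0) : F ∈ pointIdeal P ^ 2 ↔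
      ∃ q : Polynomial K, q ≠ 0 ∧ q.natDegree ≤ 2 ∧ CrossDvd n p q P := by
  obtain ⟨e, he⟩ := exists_linearEquiv_apply_eq (K := K) hP
    (w := (Pi.single 0 1 : Fin 3 → K)) (by simp)
  have hsymm : e.symm (Pi.single 0 1) = P := by rw [← he, e.symm_apply_apply]
  have hF : F ∈ pointIdeal P ^ 2 ↔
      linSubst (e.symm : _ →ₗ[K] _) F ∈ pointIdeal (Pi.single 0 1) ^ 2 := by
    constructor
    · intro hF
      exact linSubst_mem_pointIdeal_pow _ (by simpa [hsymm] using hF)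
    · intro hF
      have := linSubst_mem_pointIdeal_pow (e : (Fin 3 → K) →ₗ[K] _) (P := P)
        (by simpa [he] using hF)
      simpa using (linSubst_symm_linSubst e.symm F) ▸ this
  rw [hF, (h.linComp e).mem_pointIdeal_single_sq_iff hn]
  refine exists_congr fun q => and_congr_right fun _ => and_congr_right fun _ => ⟨?_, ?_⟩
  · intro hq
    have := hq.linComp (e.symm : (Fin 3 → K) →ₗ[K] _)
    rw [linComp_symm_linComp] at this
    simpa [hsymm] using this
  · intro hq
    simpa [he] using hq.linComp (e : (Fin 3 → K) →ₗ[K] _)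

/-- The value at `v` of the binary form of degree `n` that dehomogenizes to `h`. -/
def formEval {K : Type*} [Field K] (n : ℕ) (v : Fin 2 → K) (h : Polynomial K) : K :=
  eval ![v 1, v 0] (h.homogenize n)

lemma formEval_mul {K : Type*} [Field K] {m n : ℕ} (v : Fin 2 → K) {g h : Polynomial K}
    (hg : g.natDegree ≤ m) (hh : h.natDegree ≤ n) :
    formEval (m + n) v (g * h) = formEval m v g * formEval n v h := by
  simp [formEval, Polynomial.homogenize_mul g h hg hh]

lemma formEval_sum_C_mul {K : Type*} [Field K] {n : ℕ} (c : Fin 3 → K) (w : Fin 2 → K)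
    (p : Fin 3 → Polynomial K) :
    formEval n w (∑ u, Polynomial.C (c u) * p u) = ∑ u, c u * formEval n w (p u) := by
  simp [formEval]

lemma formEval_one_cons {K : Type*} [Field K] {n : ℕ} {h : Polynomial K} (hh : h.natDegree ≤ n)
    (τ : K) : formEval n ![1, τ] h = h.eval τ := by
  have := Polynomial.eval_homogenize hh ![τ, 1] (by simp)
  simpa [formEval] using this

/-- The linear polynomial whose associated linear form vanishes at `v`. -/
def linRoot {K : Type*} [Field K] (v : Fin 2 → K) : Polynomial K :=
  Polynomial.C (v 1) - Polynomial.C (v 0) * Polynomial.X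

lemma natDegree_linRoot_le {K : Type*} [Field K] (v : Fin 2 → K) :
    (linRoot v).natDegree ≤ 1 := by
  unfold linRoot
  compute_degree

lemma formEval_linRoot {K : Type*} [Field K] (v w : Fin 2 → K) :
    formEval 1 w (linRoot v) = v 1 * w 0 - v 0 * w 1 := by
  simp [formEval, linRoot]

lemma exists_eq_linRoot_mul {K : Type*} [Field K] {n : ℕ} {v : Fin 2 → K} (hv : v ≠ 0)
    {h : Polynomial K} (hh : h.natDegree ≤ n + 1) (h0 : formEval (n + 1) v h = 0) :
    ∃ r : Polynomial K, r.natDegree ≤ n ∧ h = linRoot v * r := by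
  by_cases hv0 : v 0 = 0
  · have hv1 : v 1 ≠ 0 := fun hv1 => hv (by ext i; fin_cases i <;> simp [hv0, hv1])
    refine ⟨Polynomial.C (v 1)⁻¹ * h, ?_, ?_⟩
    · refine (Polynomial.natDegree_C_mul_le _ _).trans (Nat.le_of_lt_succ (lt_of_le_of_ne hh ?_))
      intro (hd : h.natDegree = n + 1)
      have hlead : h.coeff (n + 1) = 0 := by
        have : formEval (n + 1) v h = h.coeff (n + 1) * v 1 ^ (n + 1) := by
          rw [formEval, Polynomial.homogenize, map_sum, Finset.sum_eq_single (n + 1, 0)]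
          · simp [eval_monomial, Finsupp.prod_fintype]
          · rintro ⟨a, b⟩ hab hne
            have hb : b ≠ 0 := by
              rintro rfl
              simp_all
            simp [eval_monomial, Finsupp.prod_fintype, hv0, hb]
          · simp
        simpa [this, hv1] using h0
      rw [← hd, Polynomial.coeff_natDegree, Polynomial.leadingCoeff_eq_zero] at hlead
      simp [hlead] at hd
    · rw [linRoot, hv0, ← mul_assoc]
      simp [← Polynomial.C_mul, hv1]
  · have hroot : h.IsRoot (v 1 / v 0) := by
      have := Polynomial.eval_homogenize hh ![v 1, v 0] (by simpa using hv0)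
      rw [formEval] at h0
      simpa [h0, hv0] using this
    obtain ⟨r, hr⟩ := Polynomial.dvd_iff_isRoot.2 hroot
    refine ⟨Polynomial.C (-(v 0)⁻¹) * r, ?_, ?_⟩
    · refine (Polynomial.natDegree_C_mul_le _ _).trans ?_
      by_cases hr0 : r = 0
      · simp [hr0]
      · rw [hr, Polynomial.natDegree_mul (Polynomial.X_sub_C_ne_zero _) hr0,
          Polynomial.natDegree_X_sub_C] at hh
        omega
    · rw [hr, linRoot, ← mul_assoc]
      congr 1
      have h1 : Polynomial.C (v 0) * Polynomial.C (v 0)⁻¹ = 1 := by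
        rw [← Polynomial.C_mul, mul_inv_cancel₀ hv0, Polynomial.C_1]
      rw [div_eq_mul_inv, Polynomial.C_mul, Polynomial.C_neg]
      linear_combination (-Polynomial.X) * h1

/-- The polynomial `g(1, X)` for a binary form `g` of degree `n`. -/
def dehom {K : Type*} [Field K] (n : ℕ) (g : MvPolynomial (Fin 2) K) : Polynomial K :=
  ∑ i : Fin (n + 1), Polynomial.C (bcoeff n g i) * Polynomial.X ^ (i : ℕ)

lemma natDegree_dehom_le {K : Type*} [Field K] (n : ℕ) (g : MvPolynomial (Fin 2) K) :
    (dehom n g).natDegree ≤ n :=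
  Polynomial.natDegree_sum_le_of_forall_le _ _ fun i _ =>
    (Polynomial.natDegree_C_mul_X_pow_le _ _).trans (Nat.le_of_lt_succ i.isLt)

lemma coeff_dehom {K : Type*} [Field K] (n : ℕ) (g : MvPolynomial (Fin 2) K) (i : Fin (n + 1)) :
    (dehom n g).coeff i = bcoeff n g i := by
  simp [dehom, Polynomial.coeff_C_mul, Polynomial.coeff_X_pow, Fin.val_inj]

lemma eval_eq_formEval_dehom {K : Type*} [Field K] {n : ℕ} {g : MvPolynomial (Fin 2) K}
    (hg : g.IsHomogeneous n) (v : Fin 2 → K) : eval v g = formEval n v (dehom n g) := by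
  have hswap : rename (Equiv.swap 0 1) g = (dehom n g).homogenize n := by
    ext m
    have hm : m = (Finsupp.single (0 : Fin 2) (m 1) + Finsupp.single 1 (m 0)).mapDomain
        (Equiv.swap (0 : Fin 2) 1) := by
      ext i
      fin_cases i <;> simp [Finsupp.mapDomain_add, Finsupp.mapDomain_single]
    rw [Polynomial.coeff_homogenize]
    split_ifs with hmn
    · conv_lhs => rw [hm, coeff_rename_mapDomain _ (Equiv.injective _)]
      have := coeff_dehom n g ⟨m 0, by omega⟩
      rw [this, bcoeff]
      rw [show n - ((⟨m 0, by omega⟩ : Fin (n + 1)) : ℕ) = m 1 from by simp only; omega]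
    · conv_lhs => rw [hm, coeff_rename_mapDomain _ (Equiv.injective _)]
      refine hg.coeff_eq_zero ?_
      rw [map_add, Finsupp.degree_single, Finsupp.degree_single]
      omega
  rw [formEval, ← hswap, eval_rename]
  congr 2
  ext i
  fin_cases i <;> simp

/-- The dehomogenization of the binary quadratic form with coefficient vector `x`. -/
def quadPoly {K : Type*} [Field K] (x : Fin 3 → K) : Polynomial K :=
  Polynomial.C (x 0) + Polynomial.C (x 1) * Polynomial.X + Polynomial.C (x 2) * Polynomial.X ^ 2

lemma natDegree_quadPoly_le {K : Type*} [Field K] (x : Fin 3 → K) :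
    (quadPoly x).natDegree ≤ 2 := by
  unfold quadPoly
  compute_degree

lemma coeff_quadPoly {K : Type*} [Field K] (x : Fin 3 → K) (i : ℕ) :
    (quadPoly x).coeff i = if h : i < 3 then x ⟨i, h⟩ else 0 := by
  split_ifs with h
  · interval_cases i <;>
      simp [quadPoly, Polynomial.coeff_X, Polynomial.coeff_C, Polynomial.coeff_X_pow]
  · exact Polynomial.coeff_eq_zero_of_natDegree_lt
      ((natDegree_quadPoly_le x).trans_lt (by omega))

lemma quadPoly_injective {K : Type*} [Field K] :
    Function.Injective (quadPoly : (Fin 3 → K) → Polynomial K) := by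
  intro x y hxy
  ext i
  simpa [coeff_quadPoly] using congrArg (fun q => Polynomial.coeff q i) hxy

lemma quadPoly_zero {K : Type*} [Field K] : quadPoly (0 : Fin 3 → K) = 0 := by
  simp [quadPoly]

lemma exists_eq_quadPoly {K : Type*} [Field K] {q : Polynomial K} (hq : q.natDegree ≤ 2) :
    ∃ x, q = quadPoly x := by
  refine ⟨fun i => q.coeff i, Polynomial.ext fun i => ?_⟩
  rw [coeff_quadPoly]
  split_ifs with h
  · rfl
  · exact Polynomial.coeff_eq_zero_of_natDegree_lt (hq.trans_lt (by omega))

/-- The polynomials whose coefficient vectors are the rows of the matrix `M_2`. -/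
def rowPoly {K : Type*} [Field K] (n : ℕ) (q : Polynomial K) (p : Fin 3 → Polynomial K)
    (j : Fin (n - 2 + 4)) : Polynomial K :=
  Fin.append (m := n - 2 + 1) (n := 3) (fun i => q * Polynomial.X ^ (i : ℕ)) p j

lemma natDegree_rowPoly_le {K : Type*} [Field K] {n : ℕ} (hn : 2 ≤ n) {q : Polynomial K}
    (hq : q.natDegree ≤ 2) {p : Fin 3 → Polynomial K} (hp : ∀ u, (p u).natDegree ≤ n)
    (j : Fin (n - 2 + 4)) : (rowPoly n q p j).natDegree ≤ n := by
  unfold rowPoly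
  refine Fin.addCases (m := n - 2 + 1) (n := 3) (fun i => ?_) (fun u => ?_) j
  · rw [Fin.append_left]
    refine (Polynomial.natDegree_mul_le_of_le hq (Polynomial.natDegree_X_pow_le _)).trans ?_
    omega
  · rw [Fin.append_right]
    exact hp u

lemma eval_Mmat {K : Type*} [Field K] {n : ℕ} (f : Fin 3 → MvPolynomial (Fin 2) K)
    (x : Fin 3 → K) (j : Fin (n - 2 + 4)) (c : Fin (n + 1)) :
    eval x (Mmat n 2 f j c) = (rowPoly n (quadPoly x) (fun u => dehom n (f u)) j).coeff c := by
  unfold rowPoly Mmat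
  refine Fin.addCases (m := n - 2 + 1) (n := 3) (fun i => ?_) (fun u => ?_) j
  · have hi : (i : ℕ) ≤ n - 2 := by omega
    rw [Fin.append_left, Polynomial.coeff_mul_X_pow', coeff_quadPoly]
    simp only [Fin.val_castAdd, hi, dite_true]
    split_ifs <;> first | omega | simp
  · have hu : ¬ (n - 2 + 1 + (u : ℕ) ≤ n - 2) := by omega
    rw [Fin.append_right, coeff_dehom]
    simp [hu]

lemma det_coeff_eq_zero_iff {K : Type*} [Field K] {N M : ℕ} (hNM : N = M)
    {c : Fin N → Fin M} (hc : Function.Injective c) {g : Fin N → Polynomial K}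
    (hg : ∀ a, (g a).natDegree < M) :
    (Matrix.of fun a b => (g a).coeff (c b)).det = 0 ↔
      ∃ y : Fin N → K, y ≠ 0 ∧ ∑ a, Polynomial.C (y a) * g a = 0 := by
  subst hNM
  rw [← Matrix.exists_vecMul_eq_zero_iff]
  refine exists_congr fun y => and_congr_right fun _ => ⟨fun h => ?_, fun h => ?_⟩
  · ext i
    by_cases hi : i < N
    · obtain ⟨b, hb⟩ := (Finite.injective_iff_surjective.1 hc) ⟨i, hi⟩
      have := congrFun h b
      simpa [Matrix.vecMul, dotProduct, hb] using this
    · rw [Polynomial.finsetSum_coeff, Polynomial.coeff_zero]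
      refine Finset.sum_eq_zero fun a _ => ?_
      rw [Polynomial.coeff_C_mul, Polynomial.coeff_eq_zero_of_natDegree_lt
        ((hg a).trans_le (not_lt.1 hi)), mul_zero]
  · ext b
    have := congrArg (fun q => Polynomial.coeff q (c b)) h
    simpa [Matrix.vecMul, dotProduct] using this

lemma eval_minors_eq_zero_iff {K : Type*} [Field K] {n : ℕ} (hn : 2 ≤ n)
    (f : Fin 3 → MvPolynomial (Fin 2) K) (x : Fin 3 → K) :
    (∀ g ∈ minorsSet n 2 f, eval x g = 0) ↔
      ∀ r : Fin (n - 2 + 3) → Fin (n - 2 + 4), Function.Injective r →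
        ∃ y : Fin (n - 2 + 3) → K, y ≠ 0 ∧
          ∑ a, Polynomial.C (y a) * rowPoly n (quadPoly x) (fun u => dehom n (f u)) (r a) = 0 := by
  have key : ∀ (r : Fin (n - 2 + 3) → Fin (n - 2 + 4)) (c : Fin (n - 2 + 3) → Fin (n + 1)),
      Function.Injective c → (eval x ((Mmat n 2 f).submatrix r c).det = 0 ↔
        ∃ y : Fin (n - 2 + 3) → K, y ≠ 0 ∧
          ∑ a, Polynomial.C (y a) * rowPoly n (quadPoly x) (fun u => dehom n (f u)) (r a) = 0) := by
    intro r c hc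
    rw [← det_coeff_eq_zero_iff (by omega) hc, RingHom.map_det]
    · refine Eq.congr (congrArg Matrix.det ?_) rfl
      ext a b
      simp [eval_Mmat]
    · intro a
      exact Nat.lt_succ_of_le (natDegree_rowPoly_le hn (natDegree_quadPoly_le x)
        (fun u => natDegree_dehom_le n (f u)) _)
  constructor
  · intro h r hr
    have hc : Function.Injective (Fin.cast (by omega) : Fin (n - 2 + 3) → Fin (n + 1)) :=
      Fin.cast_injective _
    exact (key r _ hc).1 (h _ ⟨r, _, hr, hc, rfl⟩)
  · rintro h _ ⟨r, c, hr, hc, rfl⟩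
    exact (key r c hc).2 (h r hr)

lemma exists_sum_eq_mul {K : Type*} [Field K] (q : Polynomial K) {m : ℕ} (y : Fin (m + 1) → K) :
    ∃ r : Polynomial K, r.natDegree ≤ m ∧ (∀ i : Fin (m + 1), r.coeff i = y i) ∧
      ∑ i, Polynomial.C (y i) * (q * Polynomial.X ^ (i : ℕ)) = q * r := by
  refine ⟨∑ i, Polynomial.C (y i) * Polynomial.X ^ (i : ℕ), ?_, fun i => ?_, ?_⟩
  · exact Polynomial.natDegree_sum_le_of_forall_le _ _ fun i _ =>
      (Polynomial.natDegree_C_mul_X_pow_le _ _).trans (Nat.le_of_lt_succ i.isLt)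
  · simp [Polynomial.coeff_C_mul, Polynomial.coeff_X_pow, Fin.val_inj]
  · rw [Finset.mul_sum]
    exact Finset.sum_congr rfl fun i _ => by ring

lemma exists_relation_of_crossDvd {K : Type*} [Field K] {n : ℕ}
    {p : Fin 3 → Polynomial K} {q : Polynomial K} {P : Fin 3 → K} (hP : P ≠ 0)
    (h : CrossDvd n p q P) (r : Fin (n - 2 + 3) → Fin (n - 2 + 4)) :
    ∃ y : Fin (n - 2 + 3) → K, y ≠ 0 ∧ ∑ a, Polynomial.C (y a) * rowPoly n q p (r a) = 0 := by
  classical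
  obtain ⟨i, hi⟩ := Function.ne_iff.1 hP
  rw [Pi.zero_apply] at hi
  set S : Finset (Polynomial K) :=
    insert (p i) ((Finset.range (n - 2 + 1)).image fun k => q * Polynomial.X ^ k) with hS
  have hq : ∀ k < n - 2 + 1, q * Polynomial.X ^ k ∈ Submodule.span K (S : Set (Polynomial K)) :=
    fun k hk => Submodule.subset_span (Finset.mem_coe.2 (Finset.mem_insert_of_mem
      (Finset.mem_image.2 ⟨k, Finset.mem_range.2 hk, rfl⟩)))
  have hspan : ∀ j, rowPoly n q p j ∈ Submodule.span K (S : Set (Polynomial K)) := by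
    intro j
    unfold rowPoly
    refine Fin.addCases (m := n - 2 + 1) (n := 3) (fun k => ?_) (fun u => ?_) j
    · rw [Fin.append_left]
      exact hq k k.isLt
    · rw [Fin.append_right]
      obtain ⟨s, hs, hsq⟩ := h (Pi.single u 1 - Pi.single i (P u / P i)) (by
        simp [sub_mul, Finset.sum_sub_distrib, Pi.single_apply, hi])
      have hu : p u = (P u / P i) • p i + q * s := by
        rw [← hsq]
        simp [sub_mul, Finset.sum_sub_distrib, Pi.single_apply, apply_ite Polynomial.C,
          Polynomial.smul_eq_C_mul]
      rw [hu, s.as_sum_range' (n - 2 + 1) (by omega), Finset.mul_sum]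
      refine add_mem (Submodule.smul_mem _ _ (Submodule.subset_span (by simp [hS])))
        (sum_mem fun k hk => ?_)
      rw [← Polynomial.C_mul_X_pow_eq_monomial, ← Polynomial.smul_eq_C_mul, mul_smul_comm]
      exact Submodule.smul_mem _ _ (hq k (Finset.mem_range.1 hk))
  have hdep : ¬ LinearIndependent K fun a => rowPoly n q p (r a) := by
    intro hli
    have h1 := linearIndependent_le_span_aux' _ hli (S : Set (Polynomial K)) (by
      rintro _ ⟨a, rfl⟩
      exact hspan _)
    have h2 : S.card ≤ n - 2 + 1 + 1 := (Finset.card_insert_le _ _).trans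
      (Nat.succ_le_succ (Finset.card_image_le.trans (by simp)))
    have h3 : n - 2 + 3 ≤ S.card := by simpa using h1
    omega
  obtain ⟨y, hy, a, ha⟩ := Fintype.not_linearIndependent_iff.1 hdep
  exact ⟨y, fun h0 => ha (congrFun h0 a), by simpa [Polynomial.smul_eq_C_mul] using hy⟩

lemma exists_cross_of_relation {K : Type*} [Field K] {n : ℕ}
    {p : Fin 3 → Polynomial K} {q : Polynomial K} (hq : q ≠ 0) {u₀ : Fin 3}
    {y : Fin (n - 2 + 3) → K} (hy : y ≠ 0) (hrel : ∑ a, Polynomial.C (y a) *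
      rowPoly n q p ((Fin.natAdd (n - 2 + 1) u₀ : Fin (n - 2 + 4)).succAbove a) = 0) :
    ∃ c : Fin 3 → K, c ≠ 0 ∧ c u₀ = 0 ∧
      ∃ r : Polynomial K, r.natDegree ≤ n - 2 ∧ ∑ u, Polynomial.C (c u) * p u = q * r := by
  set j₀ : Fin (n - 2 + 4) := Fin.natAdd (n - 2 + 1) u₀ with hj₀
  set z : Fin (n - 2 + 4) → K := j₀.insertNth 0 y with hz
  have hz0 : z j₀ = 0 := Fin.insertNth_apply_same _ _ _
  have hsum : ∑ j, Polynomial.C (z j) * rowPoly n q p j = 0 := by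
    rw [Fin.sum_univ_succAbove _ j₀, hz0]
    simpa [hz] using hrel
  have hsplit := Fin.sum_univ_add (a := n - 2 + 1) (b := 3)
    fun j => Polynomial.C (z j) * rowPoly n q p j
  obtain ⟨s, hs, hsc, hsq⟩ := exists_sum_eq_mul q fun i : Fin (n - 2 + 1) => z (Fin.castAdd 3 i)
  have hrel' : q * s + ∑ u : Fin 3, Polynomial.C (z (Fin.natAdd (n - 2 + 1) u)) * p u = 0 := by
    rw [← hsq, ← hsum, hsplit]
    simp [rowPoly, Fin.append_left, Fin.append_right]
  refine ⟨fun u => z (Fin.natAdd (n - 2 + 1) u), fun hc => hy ?_, hz0, -s, by simpa using hs,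
    by linear_combination hrel'⟩
  have hs0 : s = 0 := by
    have : q * s = 0 := by simpa [fun u => congrFun hc u] using hrel'
    exact (mul_eq_zero.1 this).resolve_left hq
  have hz' : z = 0 := by
    ext j
    refine Fin.addCases (m := n - 2 + 1) (n := 3) (fun k => ?_) (fun u => congrFun hc u) j
    rw [← hsc k, hs0]
    simp
  ext a
  have : z (j₀.succAbove a) = y a := Fin.insertNth_apply_succAbove _ _ _ _
  rw [← this, hz']
  rfl

/-- The linear forms `c` such that `q` divides `∑ c_u p_u`, in formal degree `n`. -/
def crossSubmodule {K : Type*} [Field K] (n : ℕ) (p : Fin 3 → Polynomial K) (q : Polynomial K) :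
    Submodule K (Fin 3 → K) where
  carrier := {c | ∃ r : Polynomial K, r.natDegree ≤ n - 2 ∧
    ∑ u, Polynomial.C (c u) * p u = q * r}
  zero_mem' := ⟨0, by simp⟩
  add_mem' := by
    rintro c d ⟨r, hr, hc⟩ ⟨s, hs, hd⟩
    exact ⟨r + s, Polynomial.natDegree_add_le_of_degree_le hr hs, by
      simp only [mul_add, ← hc, ← hd, Pi.add_apply, map_add, add_mul, Finset.sum_add_distrib]⟩
  smul_mem' := by
    rintro a c ⟨r, hr, hc⟩
    refine ⟨Polynomial.C a * r, (Polynomial.natDegree_C_mul_le _ _).trans hr, ?_⟩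
    rw [mul_left_comm, ← hc, Finset.mul_sum]
    simp [mul_assoc]

lemma exists_orthogonal_le {K : Type*} [Field K] (A : Submodule K (Fin 3 → K))
    (hA : ∀ i, ∃ c ∈ A, c ≠ 0 ∧ c i = 0) :
    ∃ P : Fin 3 → K, P ≠ 0 ∧ ∀ c : Fin 3 → K, ∑ u, c u * P u = 0 → c ∈ A := by
  by_cases htop : A = ⊤
  · exact ⟨Pi.single 0 1, by simp, fun c _ => htop ▸ Submodule.mem_top⟩
  obtain ⟨φ, hφ, hle⟩ := Submodule.exists_le_ker_of_lt_top A (lt_top_iff_ne_top.2 htop)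
  have hφc : ∀ c : Fin 3 → K, φ c = ∑ u, c u * φ (Pi.single u 1) := by
    intro c
    conv_lhs => rw [pi_eq_sum_univ' c, map_sum]
    simp
  have hfin : 2 ≤ Module.finrank K A := by
    by_contra hlt
    obtain ⟨v, hv⟩ := finrank_le_one_iff.1 (Nat.le_of_lt_succ (not_le.1 hlt))
    have hv0 : ∀ i, (v : Fin 3 → K) i = 0 := by
      intro i
      obtain ⟨c, hcA, hc, hci⟩ := hA i
      obtain ⟨a, ha⟩ := hv ⟨c, hcA⟩
      have hac : a • (v : Fin 3 → K) = c := congrArg Subtype.val ha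
      have ha0 : a ≠ 0 := by
        rintro rfl
        exact hc (by simpa using hac.symm)
      rw [← hac] at hci
      simpa [ha0] using hci
    obtain ⟨c, hcA, hc, -⟩ := hA 0
    obtain ⟨a, ha⟩ := hv ⟨c, hcA⟩
    have hac : a • (v : Fin 3 → K) = c := congrArg Subtype.val ha
    rw [_root_.funext (g := (0 : Fin 3 → K)) hv0, smul_zero] at hac
    exact hc hac.symm
  have hker : A = LinearMap.ker φ := by
    refine Submodule.eq_of_le_of_finrank_le hle ?_
    have := Module.Dual.finrank_ker_add_one_of_ne_zero hφ
    simp at this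
    omega
  refine ⟨fun u => φ (Pi.single u 1), fun h0 => hφ ?_, fun c hc => ?_⟩
  · refine LinearMap.ext fun c => ?_
    rw [hφc]
    simp [fun u => congrFun h0 u]
  · rw [hker, LinearMap.mem_ker, hφc, hc]

/-- The zero locus of the minors of `M_2`: the quadratic forms dividing the pullbacks of all lines
through some point of the plane. -/
lemma eval_minors_eq_zero_iff_exists_crossDvd {K : Type*} [Field K] {n : ℕ} (hn : 2 ≤ n)
    (f : Fin 3 → MvPolynomial (Fin 2) K) {x : Fin 3 → K} (hx : x ≠ 0) :
    (∀ g ∈ minorsSet n 2 f, eval x g = 0) ↔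
      ∃ P : Fin 3 → K, P ≠ 0 ∧ CrossDvd n (fun u => dehom n (f u)) (quadPoly x) P := by
  rw [eval_minors_eq_zero_iff hn]
  constructor
  · intro h
    have hq : quadPoly x ≠ 0 := fun h0 => hx (quadPoly_injective (h0.trans quadPoly_zero.symm))
    refine exists_orthogonal_le (crossSubmodule n (fun u => dehom n (f u)) (quadPoly x))
      fun u₀ => ?_
    obtain ⟨y, hy, hrel⟩ := h _ (Fin.succAbove_right_injective
      (p := (Fin.natAdd (n - 2 + 1) u₀ : Fin (n - 2 + 4))))
    obtain ⟨c, hc, hc0, hr⟩ := exists_cross_of_relation hq hy hrel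
    exact ⟨c, hr, hc, hc0⟩
  · rintro ⟨P, hP, h⟩ r -
    exact exists_relation_of_crossDvd hP h r

lemma CrossDvd.formEval_eq_zero {K : Type*} [Field K] {n : ℕ} (hn : 2 ≤ n)
    {p : Fin 3 → Polynomial K} {q : Polynomial K} (hq : q.natDegree ≤ 2) {P : Fin 3 → K}
    (h : CrossDvd n p q P) {v : Fin 2 → K} (hv : formEval 2 v q = 0) {c : Fin 3 → K}
    (hc : ∑ u, c u * P u = 0) : ∑ u, c u * formEval n v (p u) = 0 := by
  obtain ⟨r, hr, hrq⟩ := h c hc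
  have := formEval_mul v hq hr
  rw [Nat.add_sub_cancel' hn, ← hrq, formEval_sum_C_mul, hv, zero_mul] at this
  exact this

lemma exists_eq_smul_of_orthogonal {K : Type*} [Field K] {P Q : Fin 3 → K} (hP : P ≠ 0)
    (h : ∀ c : Fin 3 → K, ∑ u, c u * P u = 0 → ∑ u, c u * Q u = 0) : ∃ a : K, Q = a • P := by
  obtain ⟨i, hi⟩ := Function.ne_iff.1 hP
  rw [Pi.zero_apply] at hi
  refine ⟨Q i / P i, _root_.funext fun j => ?_⟩
  have := h (Pi.single j (P i) - Pi.single i (P j)) (by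
    simp only [Pi.sub_apply, sub_mul, Finset.sum_sub_distrib, Pi.single_apply, ite_mul, zero_mul,
      Finset.sum_ite_eq', Finset.mem_univ, if_true]
    ring)
  simp only [Pi.sub_apply, sub_mul, Finset.sum_sub_distrib, Pi.single_apply, ite_mul, zero_mul,
    Finset.sum_ite_eq', Finset.mem_univ, if_true] at this
  simp only [Pi.smul_apply, smul_eq_mul]
  field_simp
  linear_combination this

lemma crossDvd_linRoot_mul_linRoot {K : Type*} [Field K] {n : ℕ} (hn : 2 ≤ n)
    {p : Fin 3 → Polynomial K} (hp : ∀ u, (p u).natDegree ≤ n) {v w : Fin 2 → K}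
    (hvw : v 1 * w 0 - v 0 * w 1 ≠ 0) {P : Fin 3 → K} {a b : K}
    (hv : ∀ u, formEval n v (p u) = a * P u) (hw : ∀ u, formEval n w (p u) = b * P u) :
    CrossDvd n p (linRoot v * linRoot w) P := by
  obtain ⟨m, rfl⟩ := Nat.exists_eq_add_of_le' hn
  have hv0 : v ≠ 0 := by
    rintro rfl
    simp at hvw
  have hw0 : w ≠ 0 := by
    rintro rfl
    simp at hvw
  intro c hc
  have hdeg : (∑ u, Polynomial.C (c u) * p u).natDegree ≤ m + 1 + 1 :=
    Polynomial.natDegree_sum_le_of_forall_le _ _ fun u _ =>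
      (Polynomial.natDegree_C_mul_le _ _).trans (hp u)
  have hzero : ∀ (z : Fin 2 → K) (d : K), (∀ u, formEval (m + 2) z (p u) = d * P u) →
      formEval (m + 1 + 1) z (∑ u, Polynomial.C (c u) * p u) = 0 := by
    intro z d hz
    rw [formEval_sum_C_mul]
    simp only [hz, mul_left_comm _ d, ← Finset.mul_sum, hc, mul_zero]
  obtain ⟨r, hr, hrv⟩ := exists_eq_linRoot_mul hv0 hdeg (hzero v a hv)
  have hrw : formEval (m + 1) w r = 0 := by
    have h1 := formEval_mul w (natDegree_linRoot_le v) hr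
    rw [← hrv, add_comm 1 (m + 1), hzero w b hw, formEval_linRoot] at h1
    exact (mul_eq_zero.1 h1.symm).resolve_left hvw
  obtain ⟨s, hs, hsw⟩ := exists_eq_linRoot_mul hw0 hr hrw
  exact ⟨s, hs, by rw [hrv, hsw, mul_assoc]⟩

lemma exists_eq_linRoot {K : Type*} [Field K] {r : Polynomial K} (hr : r.natDegree ≤ 1) :
    ∃ w, r = linRoot w := by
  refine ⟨![-r.coeff 1, r.coeff 0], ?_⟩
  conv_lhs => rw [Polynomial.eq_X_add_C_of_natDegree_le_one hr]
  simp [linRoot, add_comm]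

lemma linRoot_mul_linRoot {K : Type*} [Field K] (v w : Fin 2 → K) :
    linRoot v * linRoot w = quadPoly ![v 1 * w 1, -(v 1 * w 0 + v 0 * w 1), v 0 * w 0] := by
  simp [linRoot, quadPoly]
  ring

lemma exists_formEval_two_eq_zero {K : Type*} [Field K] [IsAlgClosed K] (x : Fin 3 → K) :
    ∃ v : Fin 2 → K, v ≠ 0 ∧ formEval 2 v (quadPoly x) = 0 := by
  by_cases hx : x 2 = 0
  · refine ⟨![0, 1], by simp, ?_⟩
    simp [formEval, quadPoly, hx]
  · obtain ⟨τ, hτ⟩ := IsAlgClosed.exists_root (quadPoly x) (by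
      have h2 : (quadPoly x).coeff 2 ≠ 0 := by simpa [coeff_quadPoly] using hx
      intro h0
      exact h2 (Polynomial.coeff_eq_zero_of_degree_lt (h0 ▸ by norm_num)))
    exact ⟨![1, τ], by simp, by
      rw [formEval_one_cons (natDegree_quadPoly_le x)]
      exact hτ⟩

/-- Over an algebraically closed field a binary quadratic form splits. -/
lemma exists_quadPoly_eq {K : Type*} [Field K] [IsAlgClosed K] {x : Fin 3 → K} (hx : x ≠ 0) :
    ∃ v w : Fin 2 → K, v ≠ 0 ∧ w ≠ 0 ∧ quadPoly x = linRoot v * linRoot w := by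
  obtain ⟨v, hv, hv0⟩ := exists_formEval_two_eq_zero x
  obtain ⟨r, hr, hrx⟩ := exists_eq_linRoot_mul hv (natDegree_quadPoly_le x) hv0
  obtain ⟨w, rfl⟩ := exists_eq_linRoot hr
  refine ⟨v, w, hv, ?_, hrx⟩
  rintro rfl
  refine hx (quadPoly_injective ?_)
  rw [hrx, quadPoly_zero]
  simp [linRoot]

lemma onConic_iff {K : Type*} [Field K] {x : Fin 3 → K} {v w : Fin 2 → K}
    (h : quadPoly x = linRoot v * linRoot w) : onConic x ↔ v 1 * w 0 - v 0 * w 1 = 0 := by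
  rw [linRoot_mul_linRoot] at h
  rw [quadPoly_injective h, ← sq_eq_zero_iff, ← neg_eq_zero, onConic]
  simp only [Matrix.cons_val]
  ring_nf

lemma evalVec_eq {K : Type*} [Field K] {n : ℕ} {f : Fin 3 → MvPolynomial (Fin 2) K}
    (hf : IsProperParam n f) (v : Fin 2 → K) :
    evalVec f v = fun u => formEval n v (dehom n (f u)) :=
  _root_.funext fun u => eval_eq_formEval_dehom (hf.homog u) v

lemma projMap_mk {K : Type*} [Field K] {n : ℕ} {f : Fin 3 → MvPolynomial (Fin 2) K}
    (hf : IsProperParam n f) {v : Fin 2 → K} (hv : v ≠ 0) :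
    projMap f (Projectivization.mk K v hv)
      = Projectivization.mk K (evalVec f v) (hf.no_common_zero v hv) := by
  obtain ⟨a, ha⟩ := Projectivization.exists_smul_eq_mk_rep K v hv
  have hne := hf.no_common_zero _ (Projectivization.rep_nonzero (Projectivization.mk K v hv))
  rw [projMap, dif_pos hne, Projectivization.mk_eq_mk_iff]
  refine ⟨a ^ n, ?_⟩
  rw [← ha]
  ext u
  exact (eval_smul_of_isHomogeneous (hf.homog u) (a : K) v).symm

lemma projMap_mk_eq_iff {K : Type*} [Field K] {n : ℕ} {f : Fin 3 → MvPolynomial (Fin 2) K}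
    (hf : IsProperParam n f) {v w : Fin 2 → K} (hv : v ≠ 0) (hw : w ≠ 0) :
    projMap f (Projectivization.mk K v hv) = projMap f (Projectivization.mk K w hw) ↔
      ∃ a : K, a • evalVec f w = evalVec f v := by
  rw [projMap_mk hf, projMap_mk hf, Projectivization.mk_eq_mk_iff']

lemma mk_eq_mk_iff_det {K : Type*} [Field K] {v w : Fin 2 → K} (hv : v ≠ 0) (hw : w ≠ 0) :
    Projectivization.mk K v hv = Projectivization.mk K w hw ↔ v 1 * w 0 - v 0 * w 1 = 0 := by
  rw [Projectivization.mk_eq_mk_iff']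
  constructor
  · rintro ⟨a, rfl⟩
    simp
    ring
  · intro h
    by_cases hw0 : w 0 = 0
    · have hw1 : w 1 ≠ 0 := fun hw1 => hw (by ext i; fin_cases i <;> simp [hw0, hw1])
      have hv0 : v 0 = 0 := by simpa [hw0, hw1] using h
      refine ⟨v 1 / w 1, ?_⟩
      ext i
      fin_cases i <;> simp [hw0, hv0, hw1]
    · refine ⟨v 0 / w 0, ?_⟩
      ext i
      fin_cases i
      · simp [hw0]
      · simp
        field_simp
        linear_combination -h

/-- The affine parameterization obtained from a proper parameterization. -/
lemma IsProperParam.isAffineParam {K : Type*} [Field K] {n : ℕ}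
    {f : Fin 3 → MvPolynomial (Fin 2) K} (hf : IsProperParam n f) {F : MvPolynomial (Fin 3) K}
    (hFirr : Irreducible F) (hFhom : F.IsHomogeneous n) (hFf : aeval f F = 0) :
    IsAffineParam n (fun u => dehom n (f u)) F := by
  have hne : ∀ τ : K, (![1, τ] : Fin 2 → K) ≠ 0 := fun τ h => by simpa using congrFun h 0
  have heval : ∀ τ : K, (fun u => (dehom n (f u)).eval τ) = evalVec f ![1, τ] := by
    intro τ
    rw [evalVec_eq hf]
    exact _root_.funext fun u => (formEval_one_cons (natDegree_dehom_le n (f u)) τ).symm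
  have hinj : Function.Injective fun τ : K => Projectivization.mk K ![1, τ] (hne τ) := by
    intro τ σ h
    have := (mk_eq_mk_iff_det _ _).1 h
    simpa [sub_eq_zero] using this
  refine ⟨fun u => natDegree_dehom_le n (f u), ?_, hFirr, hFhom, fun τ => ?_⟩
  · obtain ⟨S, hS, hSinj⟩ := hf.gen_injective
    refine ⟨_, hS.preimage hinj.injOn, fun τ σ hτ hσ c hc => hinj (hSinj hτ hσ ?_)⟩
    refine (projMap_mk_eq_iff hf _ _).2 ⟨c, ?_⟩
    rw [← heval, ← heval]
    exact (_root_.funext hc).symm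
  · rw [heval]
    have h1 : (aeval (![1, τ] : Fin 2 → K)).comp (aeval f) = aeval (R := K) (evalVec f ![1, τ]) := by
      ext u
      simp [evalVec]
    have := DFunLike.congr_fun h1 F
    rw [AlgHom.comp_apply, hFf, map_zero] at this
    simpa using this.symm

lemma CrossDvd.smul_right {K : Type*} [Field K] {n : ℕ} {p : Fin 3 → Polynomial K}
    {q : Polynomial K} {P : Fin 3 → K} (h : CrossDvd n p q P) {a : K} (ha : a ≠ 0) :
    CrossDvd n p q (a • P) := by
  intro c hc
  refine h c ?_
  simp only [Pi.smul_apply, smul_eq_mul, mul_left_comm _ a, ← Finset.mul_sum] at hc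
  exact (mul_eq_zero.1 hc).resolve_left ha

lemma quadPoly_smul {K : Type*} [Field K] (a : K) (x : Fin 3 → K) :
    quadPoly (a • x) = Polynomial.C a * quadPoly x := by
  simp [quadPoly]
  ring

lemma CrossDvd.quadPoly_smul {K : Type*} [Field K] {n : ℕ} {p : Fin 3 → Polynomial K}
    {x P : Fin 3 → K} (h : CrossDvd n p (quadPoly x) P) {a : K} (ha : a ≠ 0) :
    CrossDvd n p (quadPoly (a • x)) P := by
  intro c hc
  obtain ⟨r, hr, hrq⟩ := h c hc
  refine ⟨Polynomial.C a⁻¹ * r, (Polynomial.natDegree_C_mul_le _ _).trans hr, ?_⟩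
  have h1 : Polynomial.C a * Polynomial.C a⁻¹ = 1 := by
    rw [← Polynomial.C_mul, mul_inv_cancel₀ ha, Polynomial.C_1]
  rw [hrq, _root_.quadPoly_smul]
  linear_combination (-(quadPoly x * r)) * h1

lemma linRoot_smul {K : Type*} [Field K] (a : K) (v : Fin 2 → K) :
    linRoot (a • v) = Polynomial.C a * linRoot v := by
  simp [linRoot]
  ring

lemma formEval_linRoot_mul_left {K : Type*} [Field K] (v w : Fin 2 → K) :
    formEval 2 v (linRoot v * linRoot w) = 0 := by
  have := formEval_mul v (natDegree_linRoot_le v) (natDegree_linRoot_le w)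
  rw [formEval_linRoot, mul_comm (v 1), sub_self, zero_mul] at this
  exact this

/-- The point `P` is the image of each root of a quadratic form dividing the pullbacks of the lines
through `P`. -/
lemma CrossDvd.projMap_eq {K : Type*} [Field K] {n : ℕ} (hn : 2 ≤ n)
    {f : Fin 3 → MvPolynomial (Fin 2) K} (hf : IsProperParam n f) {q : Polynomial K}
    (hq : q.natDegree ≤ 2) {P : Fin 3 → K} (hP : P ≠ 0)
    (h : CrossDvd n (fun u => dehom n (f u)) q P) {v : Fin 2 → K} (hv : v ≠ 0)
    (hroot : formEval 2 v q = 0) :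
    projMap f (Projectivization.mk K v hv) = Projectivization.mk K P hP := by
  rw [projMap_mk hf, Projectivization.mk_eq_mk_iff']
  obtain ⟨a, ha⟩ := exists_eq_smul_of_orthogonal (Q := evalVec f v) hP fun c hc => by
    rw [evalVec_eq hf]
    exact h.formEval_eq_zero hn hq hroot hc
  exact ⟨a, ha.symm⟩

lemma mem_XkSet_iff {K : Type*} [Field K] {n : ℕ} (hn : 2 ≤ n)
    {f : Fin 3 → MvPolynomial (Fin 2) K} {x : Projectivization K (Fin 3 → K)} :
    x ∈ XkSet n 2 f ↔ ∃ P : Fin 3 → K, P ≠ 0 ∧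
      CrossDvd n (fun u => dehom n (f u)) (quadPoly x.rep) P :=
  eval_minors_eq_zero_iff_exists_crossDvd hn f x.rep_nonzero

/-- If `f` is injective, a form in the zero locus of the minors has a double root. -/
lemma mk_eq_mk_of_crossDvd {K : Type*} [Field K] {n : ℕ} (hn : 2 ≤ n)
    {f : Fin 3 → MvPolynomial (Fin 2) K} (hf : IsProperParam n f)
    (hinj : Function.Injective (projMap f)) {x P : Fin 3 → K} (hP : P ≠ 0)
    (h : CrossDvd n (fun u => dehom n (f u)) (quadPoly x) P) {v w : Fin 2 → K} (hv : v ≠ 0)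
    (hw : w ≠ 0) (hvw : quadPoly x = linRoot v * linRoot w) :
    Projectivization.mk K v hv = Projectivization.mk K w hw := by
  refine hinj ?_
  rw [h.projMap_eq hn hf (natDegree_quadPoly_le x) hP hv
      (by rw [hvw, formEval_linRoot_mul_left]),
    h.projMap_eq hn hf (natDegree_quadPoly_le x) hP hw
      (by rw [hvw, mul_comm, formEval_linRoot_mul_left])]

lemma projMap_injective_of_onConic {K : Type*} [Field K] {n : ℕ} (hn : 2 ≤ n)
    {f : Fin 3 → MvPolynomial (Fin 2) K} (hf : IsProperParam n f)
    (h : ∀ x ∈ XkSet n 2 f, onConic (Projectivization.rep x)) :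
    Function.Injective (projMap f) := by
  intro V W hVW
  induction V with | h v hv
  induction W with | h w hw
  obtain ⟨a, ha⟩ := (projMap_mk_eq_iff hf hv hw).1 hVW
  rw [mk_eq_mk_iff_det]
  by_contra hdet
  have hcross := crossDvd_linRoot_mul_linRoot (p := fun u => dehom n (f u)) hn
    (fun u => natDegree_dehom_le n (f u)) hdet (P := evalVec f w) (a := a) (b := 1)
    (fun u => by
      rw [← smul_eq_mul, ← Pi.smul_apply, ha, evalVec_eq hf])
    (fun u => by rw [one_mul, evalVec_eq hf])
  set x : Fin 3 → K := ![v 1 * w 1, -(v 1 * w 0 + v 0 * w 1), v 0 * w 0] with hx_def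
  have hxq : quadPoly x = linRoot v * linRoot w := (linRoot_mul_linRoot v w).symm
  have hx : x ≠ 0 := by
    intro h0
    refine hdet ((onConic_iff hxq).1 ?_)
    simp [h0, onConic]
  obtain ⟨b, hb⟩ := Projectivization.exists_smul_eq_mk_rep K x hx
  have hb' : (b : K) • x = (Projectivization.mk K x hx).rep := hb
  have hconic := h (Projectivization.mk K x hx) ((mem_XkSet_iff hn).2
    ⟨_, hf.no_common_zero w hw, by
      rw [← hb']
      exact (hxq ▸ hcross : CrossDvd n _ (quadPoly x) _).quadPoly_smul b.ne_zero⟩)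
  rw [← hb', onConic_iff (v := (b : K) • v) (w := w)
    (by rw [quadPoly_smul, hxq, linRoot_smul, mul_assoc])] at hconic
  refine hdet ((mul_eq_zero.1 (?_ : (b : K) * _ = 0)).resolve_left b.ne_zero)
  rw [← hconic]
  simp
  ring

lemma exists_smul_eq_of_quadPoly {K : Type*} [Field K] {x y : Fin 3 → K} {v w v' w' : Fin 2 → K}
    {hv : v ≠ 0} {hw : w ≠ 0} {hv' : v' ≠ 0} {hw' : w' ≠ 0}
    (hx : quadPoly x = linRoot v * linRoot w) (hy : quadPoly y = linRoot v' * linRoot w')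
    (hvv' : Projectivization.mk K v hv = Projectivization.mk K v' hv')
    (hww' : Projectivization.mk K w hw = Projectivization.mk K w' hw') :
    ∃ a : K, a • y = x := by
  obtain ⟨a, rfl⟩ := (Projectivization.mk_eq_mk_iff' K _ _ _ _).1 hvv'
  obtain ⟨b, rfl⟩ := (Projectivization.mk_eq_mk_iff' K _ _ _ _).1 hww'
  refine ⟨a * b, quadPoly_injective ?_⟩
  rw [quadPoly_smul, hx, hy, linRoot_smul, linRoot_smul, Polynomial.C_mul]
  ring

lemma ncard_singular_eq {K : Type*} [Field K] [IsAlgClosed K] [CharZero K] {n : ℕ} (hn : 2 ≤ n)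
    {f : Fin 3 → MvPolynomial (Fin 2) K} (hf : IsProperParam n f) {F : MvPolynomial (Fin 3) K}
    (hF : IsAffineParam n (fun u => dehom n (f u)) F) (hinj : Function.Injective (projMap f)) :
    {P : Projectivization K (Fin 3 → K) | 2 ≤ multAt F P.rep}.ncard = (XkSet n 2 f).ncard := by
  have hsing : ∀ P : Projectivization K (Fin 3 → K), 2 ≤ multAt F P.rep ↔
      ∃ q : Polynomial K, q ≠ 0 ∧ q.natDegree ≤ 2 ∧
        CrossDvd n (fun u => dehom n (f u)) q P.rep := fun P => by
    rw [two_le_multAt_iff hF.isHomogeneous hF.irreducible.ne_zero,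
      hF.mem_pointIdeal_sq_iff hn P.rep_nonzero]
  have hex : ∀ x ∈ XkSet n 2 f, ∃ P : Fin 3 → K, P ≠ 0 ∧
      CrossDvd n (fun u => dehom n (f u)) (quadPoly x.rep) P := fun x hx => (mem_XkSet_iff hn).1 hx
  choose Q hQ0 hQ using hex
  symm
  refine Set.ncard_congr (fun x hx => Projectivization.mk K (Q x hx) (hQ0 x hx)) ?_ ?_ ?_
  · intro x hx
    refine (hsing _).2 ⟨quadPoly x.rep, ?_, natDegree_quadPoly_le _, ?_⟩
    · exact fun h0 => x.rep_nonzero (quadPoly_injective (h0.trans quadPoly_zero.symm))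
    · obtain ⟨a, ha⟩ := Projectivization.exists_smul_eq_mk_rep K (Q x hx) (hQ0 x hx)
      rw [← ha]
      exact (hQ x hx).smul_right a.ne_zero
  · intro x y hx hy hxy
    obtain ⟨v, w, hv, hw, hvw⟩ := exists_quadPoly_eq x.rep_nonzero
    obtain ⟨v', w', hv', hw', hvw'⟩ := exists_quadPoly_eq y.rep_nonzero
    have h1 := mk_eq_mk_of_crossDvd hn hf hinj (hQ0 x hx) (hQ x hx) hv hw hvw
    have h2 := mk_eq_mk_of_crossDvd hn hf hinj (hQ0 y hy) (hQ y hy) hv' hw' hvw'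
    have h3 : Projectivization.mk K v hv = Projectivization.mk K v' hv' := by
      refine hinj ?_
      rw [(hQ x hx).projMap_eq hn hf (natDegree_quadPoly_le _) (hQ0 x hx) hv
          (by rw [hvw, formEval_linRoot_mul_left]),
        (hQ y hy).projMap_eq hn hf (natDegree_quadPoly_le _) (hQ0 y hy) hv'
          (by rw [hvw', formEval_linRoot_mul_left])]
      exact hxy
    rw [← x.mk_rep, ← y.mk_rep, Projectivization.mk_eq_mk_iff']
    exact exists_smul_eq_of_quadPoly hvw hvw' h3 (h1.symm.trans (h3.trans h2))
  · intro P hP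
    obtain ⟨q, hq0, hq, hcross⟩ := (hsing P).1 hP
    obtain ⟨x, rfl⟩ := exists_eq_quadPoly hq
    have hx : x ≠ 0 := by
      rintro rfl
      exact hq0 quadPoly_zero
    obtain ⟨a, ha⟩ := Projectivization.exists_smul_eq_mk_rep K x hx
    have hcross' : CrossDvd n (fun u => dehom n (f u))
        (quadPoly (Projectivization.mk K x hx).rep) P.rep := by
      rw [← ha]
      exact hcross.quadPoly_smul a.ne_zero
    have hmem : Projectivization.mk K x hx ∈ XkSet n 2 f :=
      (mem_XkSet_iff hn).2 ⟨P.rep, P.rep_nonzero, hcross'⟩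
    obtain ⟨v, hv, hv0⟩ := exists_formEval_two_eq_zero (Projectivization.mk K x hx).rep
    refine ⟨_, hmem, ?_⟩
    rw [← (hQ _ hmem).projMap_eq hn hf (natDegree_quadPoly_le _) (hQ0 _ hmem) hv hv0,
      hcross'.projMap_eq hn hf (natDegree_quadPoly_le _) P.rep_nonzero hv hv0, P.mk_rep]

/-- `C` is cuspidal (the map `f : ℙ¹(K) → ℙ²(K)` is injective) if and only if every point of
`X_2(K)` lies on the conic `4x_0x_2 - x_1² = 0`; moreover, in that case the number of singular
points of `C` equals the cardinality of `X_2(K)`. -/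
theorem statement_5 {K : Type*} [Field K] [IsAlgClosed K] [CharZero K]
    (n : ℕ) (hn : 3 ≤ n) (f : Fin 3 → MvPolynomial (Fin 2) K)
    (hf : IsProperParam n f)
    (F : MvPolynomial (Fin 3) K) (hFirr : Irreducible F) (hFhom : F.IsHomogeneous n)
    (hFf : MvPolynomial.aeval f F = 0) :
    (Function.Injective (projMap f) ↔
      ∀ P ∈ XkSet n 2 f, onConic (Projectivization.rep P)) ∧
    (Function.Injective (projMap f) →
      {P : Projectivization K (Fin 3 → K) | 2 ≤ multAt F P.rep}.ncard
        = (XkSet n 2 f).ncard) := by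
  have hn2 : 2 ≤ n := by omega
  refine ⟨⟨fun hinj x hx => ?_, projMap_injective_of_onConic hn2 hf⟩,
    ncard_singular_eq hn2 hf (hf.isAffineParam hFirr hFhom hFf)⟩
  obtain ⟨P, hP, h⟩ := (mem_XkSet_iff hn2).1 hx
  obtain ⟨v, w, hv, hw, hvw⟩ := exists_quadPoly_eq x.rep_nonzero
  exact (onConic_iff hvw).2
    ((mk_eq_mk_iff_det hv hw).1 (mk_eq_mk_of_crossDvd hn2 hf hinj hP h hv hw hvw))

end
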